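/- arXiv:2605.05619 — 12 statements merged into one kernel-verified Lean document; each statement's English description precedes it below -/
import Mathlib

section
/- Let (a_k)_{k≥0} be a real sequence with ∑_{k=0}^∞ |a_k| < ∞ and semi-generating function a(θ) = ∑_{k=0}^∞ a_k e^{ikθ}. For n ≥ 1 let P_{L,n} be the n×n lower triangular Toeplitz matrix built from (a_k), and let S = (P_{L,n} + P_{L,n}^T)/2 be its real symmetric part. Then every eigenvalue λ of S satisfies min_{θ∈[0,2π)} Re(a(θ)) ≤ λ ≤ max_{θ∈[0,2π)} Re(a(θ)). In particular, if Re(a(θ)) > 0 for all θ ∈ [0,2π), then S is positive definite, i.e. the quadratic form Q_n(w) = ∑_{k=1}^n w_k ∑_{j=1}^k a_{k−j} w_j is positive for every nonzero real vector (w_1,…,w_n). -/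
open Real Set Matrix

/-- Semi-generating function `a(θ) = ∑_{k=0}^∞ a_k e^{ikθ}` of a real sequence. -/
noncomputable def semiGen (a : ℕ → ℝ) (θ : ℝ) : ℂ :=
  ∑' k : ℕ, (a k : ℂ) * Complex.exp (Complex.I * k * θ)

/-- The n×n lower triangular Toeplitz matrix built from a real sequence. -/
def toeplitzL (a : ℕ → ℝ) (n : ℕ) : Matrix (Fin n) (Fin n) ℝ :=
  Matrix.of fun j k => if (k : ℕ) ≤ (j : ℕ) then a ((j : ℕ) - (k : ℕ)) else 0

/-- The Fourier integrals of `e^{imθ}` over a period. -/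
lemma integral_exp_int_mul (m : ℤ) :
    ∫ θ in (0:ℝ)..(2 * π), Complex.exp (Complex.I * m * θ) = if m = 0 then 2 * (π : ℂ) else 0 := by
  split_ifs with h
  · simp [h]
  · have hc : Complex.I * (m : ℂ) ≠ 0 := mul_ne_zero Complex.I_ne_zero (Int.cast_ne_zero.mpr h)
    rw [integral_exp_mul_complex hc]
    have : Complex.I * (m : ℂ) * ((2 * π : ℝ) : ℂ) = m * (2 * π * Complex.I) := by
      push_cast; ring
    rw [this, Complex.exp_int_mul_two_pi_mul_I]
    simp

lemma norm_semiGen_term (a : ℕ → ℝ) (k : ℕ) (θ : ℝ) :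
    ‖(a k : ℂ) * Complex.exp (Complex.I * k * θ)‖ = |a k| := by
  have : Complex.I * (k : ℂ) * (θ : ℂ) = ((k * θ : ℝ) : ℂ) * Complex.I := by push_cast; ring
  rw [norm_mul, this, Complex.norm_exp_ofReal_mul_I, mul_one, Complex.norm_real, norm_eq_abs]

lemma continuous_semiGen {a : ℕ → ℝ} (hsum : Summable fun k => |a k|) :
    Continuous (semiGen a) :=
  continuous_tsum (fun _ => by fun_prop) hsum fun k θ => (norm_semiGen_term a k θ).le

lemma norm_semiGen_le {a : ℕ → ℝ} (hsum : Summable fun k => |a k|) (θ : ℝ) :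
    ‖semiGen a θ‖ ≤ ∑' k, |a k| :=
  tsum_of_norm_bounded hsum.hasSum fun k => (norm_semiGen_term a k θ).le

lemma semiGen_two_pi (a : ℕ → ℝ) : semiGen a (2 * π) = semiGen a 0 := by
  refine tsum_congr fun k => ?_
  have : Complex.I * (k : ℂ) * ((2 * π : ℝ) : ℂ) = k * (2 * π * Complex.I) := by
    push_cast; ring
  rw [this, Complex.exp_nat_mul_two_pi_mul_I]
  simp

lemma semiGen_neg (a : ℕ → ℝ) (θ : ℝ) : semiGen (fun k => -a k) θ = -semiGen a θ := by
  simp [semiGen, tsum_neg]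

lemma semiGen_single (θ : ℝ) : semiGen (Pi.single 0 1) θ = 1 := by
  rw [semiGen, tsum_eq_single 0]
  · simp
  · intro k hk
    simp [hk]

/-- The Fourier coefficients of the semi-generating function are the terms of the sequence. -/
lemma integral_semiGen_mul_exp {a : ℕ → ℝ} (hsum : Summable fun k => |a k|) (j l : ℕ) :
    ∫ θ in (0:ℝ)..(2 * π), semiGen a θ * Complex.exp (Complex.I * ((l : ℤ) - j : ℤ) * θ) =
      2 * π * (if l ≤ j then (a (j - l) : ℂ) else 0) := by
  have hterm (k : ℕ) (θ : ℝ) : (a k : ℂ) * Complex.exp (Complex.I * k * θ) *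
      Complex.exp (Complex.I * ((l : ℤ) - j : ℤ) * θ) =
      a k * Complex.exp (Complex.I * ((k : ℤ) + l - j : ℤ) * θ) := by
    rw [mul_assoc, ← Complex.exp_add]
    congr 2
    push_cast; ring
  have hnorm (k : ℕ) (θ : ℝ) : ‖(a k : ℂ) * Complex.exp (Complex.I * k * θ) *
      Complex.exp (Complex.I * ((l : ℤ) - j : ℤ) * θ)‖ = |a k| := by
    have : Complex.I * (((l : ℤ) - j : ℤ) : ℂ) * (θ : ℂ) =
        ((((l : ℤ) - j : ℤ) * θ : ℝ) : ℂ) * Complex.I := by push_cast; ring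
    rw [norm_mul, norm_semiGen_term, this, Complex.norm_exp_ofReal_mul_I, mul_one]
  have hsg (θ : ℝ) : Summable fun k : ℕ => (a k : ℂ) * Complex.exp (Complex.I * k * θ) :=
    Summable.of_norm (by simpa only [norm_semiGen_term] using hsum)
  have hint := intervalIntegral.hasSum_integral_of_dominated_convergence
    (μ := MeasureTheory.volume) (a := 0) (b := 2 * π)
    (F := fun (k : ℕ) (θ : ℝ) => (a k : ℂ) * Complex.exp (Complex.I * k * θ) *
      Complex.exp (Complex.I * ((l : ℤ) - j : ℤ) * θ))
    (f := fun θ => semiGen a θ * Complex.exp (Complex.I * ((l : ℤ) - j : ℤ) * θ))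
    (fun k _ => |a k|)
    (fun k => Continuous.aestronglyMeasurable (by fun_prop))
    (fun k => Filter.Eventually.of_forall fun θ _ => (hnorm k θ).le)
    (Filter.Eventually.of_forall fun θ _ => hsum)
    (by simp)
    (Filter.Eventually.of_forall fun θ _ => (hsg θ).hasSum.mul_right _)
  rw [← hint.tsum_eq]
  simp only [hterm, intervalIntegral.integral_const_mul, integral_exp_int_mul]
  split_ifs with h
  · rw [tsum_eq_single (j - l)]
    · rw [if_pos (by lia)]
      ring
    · intro k hk
      rw [if_neg (by lia), mul_zero]
  · rw [mul_zero]
    convert tsum_zero with k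
    rw [if_neg (by lia), mul_zero]

/-- The trigonometric polynomial `∑ w_j e^{ijθ}`. -/
noncomputable def trigPoly {n : ℕ} (w : Fin n → ℝ) (θ : ℝ) : ℂ :=
  ∑ j, (w j : ℂ) * Complex.exp (Complex.I * (j : ℕ) * θ)

lemma continuous_trigPoly {n : ℕ} (w : Fin n → ℝ) : Continuous (trigPoly w) := by
  unfold trigPoly
  fun_prop

lemma normSq_trigPoly {n : ℕ} (w : Fin n → ℝ) (θ : ℝ) :
    (Complex.normSq (trigPoly w θ) : ℂ) = ∑ j : Fin n, ∑ l : Fin n,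
      (w j * w l : ℂ) * Complex.exp (Complex.I * (((l : ℕ) : ℤ) - ((j : ℕ) : ℤ) : ℤ) * θ) := by
  rw [Complex.normSq_eq_conj_mul_self, trigPoly, map_sum, Finset.sum_mul_sum]
  refine Finset.sum_congr rfl fun j _ => Finset.sum_congr rfl fun l _ => ?_
  rw [map_mul, ← Complex.exp_conj, mul_mul_mul_comm, ← Complex.exp_add]
  simp only [map_mul, Complex.conj_ofReal, Complex.conj_I, map_natCast]
  congr 2
  push_cast; ring

/-- The quadratic form of the Toeplitz matrix as a weighted mean of `Re a(θ)`. -/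
lemma integral_re_semiGen_mul_normSq {a : ℕ → ℝ} (hsum : Summable fun k => |a k|) {n : ℕ}
    (w : Fin n → ℝ) :
    ∫ θ in (0:ℝ)..(2 * π), (semiGen a θ).re * Complex.normSq (trigPoly w θ) =
      2 * π * (w ⬝ᵥ toeplitzL a n *ᵥ w) := by
  have hcont := continuous_semiGen hsum
  have hc : ∫ θ in (0:ℝ)..(2 * π), semiGen a θ * Complex.normSq (trigPoly w θ) =
      ((2 * π * (w ⬝ᵥ toeplitzL a n *ᵥ w) : ℝ) : ℂ) := by
    simp only [normSq_trigPoly, Finset.mul_sum]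
    rw [intervalIntegral.integral_finsetSum
      fun j _ => Continuous.intervalIntegrable (by fun_prop) _ _]
    simp only [dotProduct, mulVec, Finset.mul_sum, Complex.ofReal_sum]
    refine Finset.sum_congr rfl fun j _ => ?_
    rw [intervalIntegral.integral_finsetSum
      fun j _ => Continuous.intervalIntegrable (by fun_prop) _ _]
    refine Finset.sum_congr rfl fun l _ => ?_
    simp only [mul_left_comm (semiGen a _)]
    rw [intervalIntegral.integral_const_mul, integral_semiGen_mul_exp hsum]
    simp only [toeplitzL, of_apply]
    split_ifs <;> push_cast <;> ring
  have hi : IntervalIntegrable (fun θ => semiGen a θ * Complex.normSq (trigPoly w θ))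
      MeasureTheory.volume 0 (2 * π) := by
    have := continuous_trigPoly w
    have := Complex.continuous_normSq
    exact Continuous.intervalIntegrable (by fun_prop) _ _
  have hre := Complex.reCLM.intervalIntegral_comp_comm hi
  rw [hc] at hre
  simpa only [Complex.reCLM_apply, Complex.re_mul_ofReal, Complex.ofReal_re] using hre

lemma toeplitzL_single (n : ℕ) : toeplitzL (Pi.single 0 1) n = 1 := by
  ext j k
  simp only [toeplitzL, of_apply, Matrix.one_apply, Pi.single_apply, Fin.ext_iff]
  grind

lemma toeplitzL_neg (a : ℕ → ℝ) (n : ℕ) : toeplitzL (fun k => -a k) n = -toeplitzL a n := by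
  ext j k
  simp only [toeplitzL, of_apply, Matrix.neg_apply]
  split_ifs <;> simp

/-- A lower bound of `Re a(θ)` is a lower bound of the Toeplitz quadratic form. -/
lemma mul_dotProduct_le_toeplitzL {a : ℕ → ℝ} (hsum : Summable fun k => |a k|) {c : ℝ}
    (hc : ∀ θ ∈ Set.Ico (0:ℝ) (2 * π), c ≤ (semiGen a θ).re) {n : ℕ} (w : Fin n → ℝ) :
    c * (w ⬝ᵥ w) ≤ w ⬝ᵥ toeplitzL a n *ᵥ w := by
  have hpi := Real.two_pi_pos
  have hone : ∫ θ in (0:ℝ)..(2 * π), Complex.normSq (trigPoly w θ) = 2 * π * (w ⬝ᵥ w) := by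
    have hs : Summable fun k => |(Pi.single 0 1 : ℕ → ℝ) k| :=
      summable_of_ne_finset_zero (s := {0}) fun k hk => by
        simp [Finset.mem_singleton.not.mp hk]
    simpa [semiGen_single, toeplitzL_single] using integral_re_semiGen_mul_normSq hs w
  have hW : Continuous fun θ => Complex.normSq (trigPoly w θ) :=
    Complex.continuous_normSq.comp (continuous_trigPoly w)
  have ha : Continuous fun θ => (semiGen a θ).re :=
    Complex.continuous_re.comp (continuous_semiGen hsum)
  have hle : ∫ θ in (0:ℝ)..(2 * π), c * Complex.normSq (trigPoly w θ) ≤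
      ∫ θ in (0:ℝ)..(2 * π), (semiGen a θ).re * Complex.normSq (trigPoly w θ) :=
    intervalIntegral.integral_mono_on_of_le_Ioo hpi.le
      ((continuous_const.mul hW).intervalIntegrable _ _) ((ha.mul hW).intervalIntegrable _ _)
      fun θ hθ => mul_le_mul_of_nonneg_right (hc θ (Set.Ioo_subset_Ico_self hθ))
        (Complex.normSq_nonneg _)
  rw [intervalIntegral.integral_const_mul, hone, integral_re_semiGen_mul_normSq hsum] at hle
  refine le_of_mul_le_mul_left ?_ hpi
  linarith

lemma dotProduct_symmPart_mulVec {ι : Type*} [Fintype ι] (A : Matrix ι ι ℝ) (v : ι → ℝ) :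
    v ⬝ᵥ ((1/2 : ℝ) • (A + Aᵀ)) *ᵥ v = v ⬝ᵥ A *ᵥ v := by
  have h : v ⬝ᵥ Aᵀ *ᵥ v = v ⬝ᵥ A *ᵥ v := by
    rw [mulVec_transpose, dotProduct_comm, dotProduct_mulVec]
  rw [smul_mulVec, add_mulVec, dotProduct_smul, dotProduct_add, h, smul_eq_mul]
  ring

lemma dotProduct_toeplitzL_mulVec (a : ℕ → ℝ) {n : ℕ} (w : Fin n → ℝ) :
    w ⬝ᵥ toeplitzL a n *ᵥ w =
      ∑ k : Fin n, w k * ∑ j ∈ Finset.Iic k, a ((k:ℕ) - (j:ℕ)) * w j := by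
  simp only [dotProduct, mulVec, toeplitzL, of_apply]
  refine Finset.sum_congr rfl fun k _ => ?_
  congr 1
  have : Finset.Iic k = Finset.univ.filter fun j : Fin n => (j : ℕ) ≤ k := by
    ext j
    simp
  rw [this, Finset.sum_filter]
  refine Finset.sum_congr rfl fun j _ => ?_
  split_ifs <;> simp

/-- eigenvalue bounds for the symmetric part of a lower
triangular Toeplitz matrix via the semi-generating function, and the
positive definiteness criterion. -/
theorem stmt0 (a : ℕ → ℝ) (hsum : Summable fun k => |a k|) :
    (∀ n : ℕ, 1 ≤ n → ∀ (μ : ℝ) (v : Fin n → ℝ), v ≠ 0 →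
      ((1/2 : ℝ) • (toeplitzL a n + (toeplitzL a n)ᵀ)).mulVec v = μ • v →
      sInf ((fun θ : ℝ => (semiGen a θ).re) '' Set.Ico (0:ℝ) (2*π)) ≤ μ ∧
      μ ≤ sSup ((fun θ : ℝ => (semiGen a θ).re) '' Set.Ico (0:ℝ) (2*π))) ∧
    ((∀ θ ∈ Set.Ico (0:ℝ) (2*π), 0 < (semiGen a θ).re) →
      ∀ n : ℕ, 1 ≤ n → ∀ w : Fin n → ℝ, w ≠ 0 →
        0 < ∑ k : Fin n, w k * ∑ j ∈ Finset.Iic k, a ((k:ℕ) - (j:ℕ)) * w j) := by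
  have hpos {n : ℕ} {w : Fin n → ℝ} (hw : w ≠ 0) : 0 < w ⬝ᵥ w :=
    (Finset.sum_nonneg fun i _ => mul_self_nonneg (w i)).lt_of_ne'
      (dotProduct_self_eq_zero.not.mpr hw)
  have habs (θ : ℝ) := abs_le.mp ((Complex.abs_re_le_norm _).trans (norm_semiGen_le hsum θ))
  constructor
  · intro n _ μ v hv hμ
    have hq : v ⬝ᵥ toeplitzL a n *ᵥ v = μ * (v ⬝ᵥ v) := by
      rw [← dotProduct_symmPart_mulVec, hμ, dotProduct_smul, smul_eq_mul]
    constructor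
    · refine le_of_mul_le_mul_right ?_ (hpos hv)
      rw [← hq]
      refine mul_dotProduct_le_toeplitzL hsum (fun θ hθ => ?_) v
      refine csInf_le ?_ ⟨θ, hθ, rfl⟩
      exact ⟨_, by rintro _ ⟨θ, _, rfl⟩; exact (habs θ).1⟩
    · refine le_of_mul_le_mul_right ?_ (hpos hv)
      rw [← hq]
      have h := mul_dotProduct_le_toeplitzL (a := fun k => -a k)
        (c := -sSup ((fun θ : ℝ => (semiGen a θ).re) '' Set.Ico (0:ℝ) (2*π)))
        (by simpa using hsum) (fun θ hθ => by
          rw [semiGen_neg, Complex.neg_re, neg_le_neg_iff]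
          refine le_csSup ?_ ⟨θ, hθ, rfl⟩
          exact ⟨_, by rintro _ ⟨θ, _, rfl⟩; exact (habs θ).2⟩) v
      rw [toeplitzL_neg, neg_mulVec, dotProduct_neg] at h
      linarith
  · intro hre n _ w hw
    rw [← dotProduct_toeplitzL_mulVec]
    obtain ⟨θ₀, hθ₀, hmin⟩ := isCompact_Icc.exists_isMinOn
      (Set.nonempty_Icc.mpr Real.two_pi_pos.le)
      (Complex.continuous_re.comp (continuous_semiGen hsum)).continuousOn
    have hθ₀pos : 0 < (semiGen a θ₀).re := by
      rcases hθ₀.2.eq_or_lt with h | h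
      · rw [h, semiGen_two_pi]
        exact hre 0 (Set.left_mem_Ico.mpr Real.two_pi_pos)
      · exact hre θ₀ ⟨hθ₀.1, h⟩
    exact (mul_pos hθ₀pos (hpos hw)).trans_le <|
      mul_dotProduct_le_toeplitzL hsum (fun θ hθ => hmin (Set.Ico_subset_Icc_self hθ)) w
end

section
/- Let (c_k)_{k≥0} be a real sequence with ∑_{k=0}^∞ |c_k| < ∞ and semi-generating function c(θ) = ∑_{k=0}^∞ c_k e^{ikθ}, and set λ := min_{θ∈[0,2π)} Re(c(θ)). Then for every n ≥ 1 and every real sequence (v_1,…,v_n), the lower triangular convolution quadratic form satisfies ∑_{i=1}^n v_i ∑_{j=1}^i c_{i−j} v_j ≥ λ ∑_{i=1}^n v_i². -/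
open Real Set

theorem integral_cos_int_mul (m : ℤ) :
    ∫ θ in (0:ℝ)..2 * π, Real.cos (m * θ) = if m = 0 then 2 * π else 0 := by
  split_ifs with h
  · simp [h]
  · have hm : (m : ℝ) ≠ 0 := by exact_mod_cast h
    have hs : Real.sin (m * (2 * π)) = 0 := by
      rw [← Real.sin_int_mul_pi (m * 2)]
      congr 1
      push_cast
      ring
    rw [intervalIntegral.integral_comp_mul_left (fun x => Real.cos x) hm]
    simp [hs]

theorem integral_cos_sub_mul_cos (i j k : ℕ) :
    ∫ θ in (0:ℝ)..2 * π, Real.cos (((i:ℝ) - j) * θ) * Real.cos (k * θ) =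
      π * ((if i = j + k then 1 else 0) + (if j = i + k then 1 else 0)) := by
  have key : ∀ θ : ℝ, Real.cos (((i:ℝ) - j) * θ) * Real.cos (k * θ) =
      (1 / 2) * (Real.cos (((i - j - k : ℤ) : ℝ) * θ) +
        Real.cos (((i - j + k : ℤ) : ℝ) * θ)) := by
    intro θ
    push_cast
    rw [show ((i:ℝ) - j - k) * θ = ((i:ℝ) - j) * θ - k * θ by ring,
      show ((i:ℝ) - j + k) * θ = ((i:ℝ) - j) * θ + k * θ by ring, Real.cos_sub, Real.cos_add]
    ring
  simp_rw [key]
  rw [intervalIntegral.integral_const_mul, intervalIntegral.integral_add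
    (Continuous.intervalIntegrable (by fun_prop) _ _)
    (Continuous.intervalIntegrable (by fun_prop) _ _),
    integral_cos_int_mul, integral_cos_int_mul]
  have h1 : ((i - j - k : ℤ) = 0) ↔ i = j + k := by omega
  have h2 : ((i - j + k : ℤ) = 0) ↔ j = i + k := by omega
  simp only [h1, h2]
  split_ifs <;> ring

/-- The squared modulus of `∑ v_i e^{iθ}`, written as a cosine polynomial. -/
noncomputable def trigEnergy {n : ℕ} (v : Fin n → ℝ) (θ : ℝ) : ℝ :=
  ∑ i, ∑ j, v i * v j * Real.cos (((i:ℕ) - (j:ℕ) : ℝ) * θ)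

theorem continuous_trigEnergy {n : ℕ} (v : Fin n → ℝ) : Continuous (trigEnergy v) := by
  unfold trigEnergy
  fun_prop

theorem trigEnergy_nonneg {n : ℕ} (v : Fin n → ℝ) (θ : ℝ) : 0 ≤ trigEnergy v θ := by
  have h : trigEnergy v θ =
      (∑ i, v i * Real.cos ((i:ℕ) * θ)) ^ 2 + (∑ i, v i * Real.sin ((i:ℕ) * θ)) ^ 2 := by
    unfold trigEnergy
    rw [sq, sq, Finset.sum_mul_sum, Finset.sum_mul_sum, ← Finset.sum_add_distrib]
    refine Finset.sum_congr rfl fun i _ => ?_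
    rw [← Finset.sum_add_distrib]
    refine Finset.sum_congr rfl fun j _ => ?_
    rw [sub_mul, Real.cos_sub]
    ring
  rw [h]
  positivity

theorem integral_trigEnergy_mul_cos {n : ℕ} (v : Fin n → ℝ) (k : ℕ) :
    ∫ θ in (0:ℝ)..2 * π, trigEnergy v θ * Real.cos (k * θ) =
      2 * π * ∑ i : Fin n, ∑ j : Fin n, if (i:ℕ) = j + k then v i * v j else 0 := by
  have h1 : ∀ θ : ℝ, trigEnergy v θ * Real.cos (k * θ) = ∑ i : Fin n, ∑ j : Fin n,
      v i * v j * (Real.cos (((i:ℕ) - (j:ℕ) : ℝ) * θ) * Real.cos (k * θ)) := by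
    intro θ
    simp only [trigEnergy, Finset.sum_mul, mul_assoc]
  simp_rw [h1]
  rw [intervalIntegral.integral_finsetSum
    fun i _ => Continuous.intervalIntegrable (by fun_prop) _ _]
  have h2 : ∀ i : Fin n, ∫ θ in (0:ℝ)..2 * π, ∑ j : Fin n,
      v i * v j * (Real.cos (((i:ℕ) - (j:ℕ) : ℝ) * θ) * Real.cos (k * θ)) =
      ∑ j : Fin n, (π * (if (i:ℕ) = j + k then v i * v j else 0) +
        π * (if (j:ℕ) = i + k then v j * v i else 0)) := by
    intro i
    rw [intervalIntegral.integral_finsetSum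
      fun i _ => Continuous.intervalIntegrable (by fun_prop) _ _]
    refine Finset.sum_congr rfl fun j _ => ?_
    rw [intervalIntegral.integral_const_mul, integral_cos_sub_mul_cos]
    split_ifs <;> ring
  simp_rw [h2, Finset.sum_add_distrib, ← Finset.mul_sum]
  rw [Finset.sum_comm (f := fun i j : Fin n => if (j:ℕ) = i + k then v j * v i else 0)]
  ring

theorem hasSum_convolution_form (c : ℕ → ℝ) {n : ℕ} (v : Fin n → ℝ) :
    HasSum (fun k => c k * ∑ i : Fin n, ∑ j : Fin n, if (i:ℕ) = j + k then v i * v j else 0)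
      (∑ i : Fin n, v i * ∑ j ∈ Finset.Iic i, c ((i:ℕ) - (j:ℕ)) * v j) := by
  simp_rw [Finset.mul_sum]
  refine hasSum_sum fun i _ => ?_
  have h : ∑ j ∈ Finset.Iic i, v i * (c ((i:ℕ) - (j:ℕ)) * v j) =
      ∑ j : Fin n, if j ≤ i then v i * (c ((i:ℕ) - (j:ℕ)) * v j) else 0 := by
    rw [← Finset.sum_filter]
    refine Finset.sum_congr ?_ fun _ _ => rfl
    ext j
    simp
  rw [h]
  refine hasSum_sum fun j _ => ?_
  convert hasSum_single (f := fun k => c k * if (i:ℕ) = j + k then v i * v j else 0)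
    ((i:ℕ) - (j:ℕ)) ?_ using 1
  · by_cases hij : j ≤ i
    · have : (i:ℕ) = j + (i - j) := by have : (j:ℕ) ≤ i := hij; omega
      rw [if_pos hij, if_pos this]
      ring
    · have : ¬ (i:ℕ) = j + (i - j) := by have : ¬ (j:ℕ) ≤ i := hij; omega
      rw [if_neg hij, if_neg this, mul_zero]
  · intro k hk
    rw [if_neg (by omega), mul_zero]

theorem summable_mul_cos {c : ℕ → ℝ} (hsum : Summable fun k => |c k|) (θ : ℝ) :
    Summable fun k : ℕ => c k * Real.cos (k * θ) :=
  Summable.of_norm_bounded hsum fun k => by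
    rw [Real.norm_eq_abs, abs_mul]
    exact mul_le_of_le_one_right (abs_nonneg _) (Real.abs_cos_le_one _)

theorem continuous_tsum_mul_cos {c : ℕ → ℝ} (hsum : Summable fun k => |c k|) :
    Continuous fun θ : ℝ => ∑' k : ℕ, c k * Real.cos (k * θ) :=
  continuous_tsum (fun k => by fun_prop) hsum fun k θ => by
    rw [Real.norm_eq_abs, abs_mul]
    exact mul_le_of_le_one_right (abs_nonneg _) (Real.abs_cos_le_one _)

theorem re_tsum_mul_exp {c : ℕ → ℝ} (hsum : Summable fun k => |c k|) (θ : ℝ) :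
    (∑' k : ℕ, (c k : ℂ) * Complex.exp (Complex.I * k * θ)).re =
      ∑' k : ℕ, c k * Real.cos (k * θ) := by
  have harg : ∀ k : ℕ, Complex.I * k * θ = ((k * θ : ℝ) : ℂ) * Complex.I := by
    intro k
    push_cast
    ring
  have hs : Summable fun k : ℕ => (c k : ℂ) * Complex.exp (Complex.I * k * θ) :=
    Summable.of_norm_bounded hsum fun k => by
      rw [harg, norm_mul, Complex.norm_exp_ofReal_mul_I, mul_one, Complex.norm_real,
        Real.norm_eq_abs]
  rw [Complex.re_tsum hs]
  refine tsum_congr fun k => ?_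
  rw [harg, Complex.re_ofReal_mul, Complex.exp_ofReal_mul_I_re]

theorem integral_trigEnergy_mul_tsum {c : ℕ → ℝ} (hsum : Summable fun k => |c k|)
    {n : ℕ} (v : Fin n → ℝ) :
    ∫ θ in (0:ℝ)..2 * π, trigEnergy v θ * ∑' k : ℕ, c k * Real.cos (k * θ) =
      2 * π * ∑ i : Fin n, v i * ∑ j ∈ Finset.Iic i, c ((i:ℕ) - (j:ℕ)) * v j := by
  have hP := continuous_trigEnergy v
  have h := intervalIntegral.hasSum_integral_of_dominated_convergence
    (μ := MeasureTheory.volume) (a := 0) (b := 2 * π)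
    (F := fun (k : ℕ) θ => trigEnergy v θ * (c k * Real.cos (k * θ)))
    (f := fun θ => trigEnergy v θ * ∑' k : ℕ, c k * Real.cos (k * θ))
    (fun k θ => trigEnergy v θ * |c k|)
    (fun k => Continuous.aestronglyMeasurable (by fun_prop))
    (fun k => Filter.Eventually.of_forall fun θ _ => by
      rw [Real.norm_eq_abs, abs_mul, abs_mul, abs_of_nonneg (trigEnergy_nonneg v θ)]
      exact mul_le_mul_of_nonneg_left
        (mul_le_of_le_one_right (abs_nonneg _) (Real.abs_cos_le_one _)) (trigEnergy_nonneg v θ))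
    (Filter.Eventually.of_forall fun θ _ => hsum.mul_left _)
    (by
      simp_rw [tsum_mul_left]
      exact Continuous.intervalIntegrable (by fun_prop) _ _)
    (Filter.Eventually.of_forall fun θ _ => (summable_mul_cos hsum θ).hasSum.mul_left _)
  have hterm : ∀ k : ℕ, ∫ θ in (0:ℝ)..2 * π, trigEnergy v θ * (c k * Real.cos (k * θ)) =
      2 * π * (c k * ∑ i : Fin n, ∑ j : Fin n, if (i:ℕ) = j + k then v i * v j else 0) := by
    intro k
    simp_rw [mul_left_comm (trigEnergy v _) (c k)]
    rw [intervalIntegral.integral_const_mul, integral_trigEnergy_mul_cos]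
    ring
  simp_rw [hterm] at h
  exact h.unique ((hasSum_convolution_form c v).mul_left (2 * π))

/-- lower bound of the lower triangular convolution quadratic
form by the minimum of the real part of the semi-generating function. -/
theorem stmt4 (c : ℕ → ℝ) (hsum : Summable fun k => |c k|)
    (lam : ℝ)
    (hlam : lam = sInf ((fun θ : ℝ =>
        (∑' k : ℕ, (c k : ℂ) * Complex.exp (Complex.I * k * θ)).re) ''
        Set.Ico (0:ℝ) (2*π)))
    (n : ℕ) (hn : 1 ≤ n) (v : Fin n → ℝ) :
    lam * ∑ i : Fin n, (v i) ^ 2 ≤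
      ∑ i : Fin n, v i * ∑ j ∈ Finset.Iic i, c ((i:ℕ) - (j:ℕ)) * v j := by
  simp_rw [re_tsum_mul_exp hsum] at hlam
  have hP := continuous_trigEnergy v
  have hc := continuous_tsum_mul_cos hsum
  have hbdd : BddBelow ((fun θ : ℝ => ∑' k : ℕ, c k * Real.cos (k * θ)) ''
      Set.Ico (0:ℝ) (2 * π)) :=
    (isCompact_Icc.bddBelow_image hc.continuousOn).mono (Set.image_mono Set.Ico_subset_Icc_self)
  have hle : ∀ θ ∈ Set.Ioo (0:ℝ) (2 * π), lam ≤ ∑' k : ℕ, c k * Real.cos (k * θ) :=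
    fun θ hθ => hlam ▸ csInf_le hbdd ⟨θ, Set.Ioo_subset_Ico_self hθ, rfl⟩
  have hint : ∫ θ in (0:ℝ)..2 * π, trigEnergy v θ * lam ≤
      ∫ θ in (0:ℝ)..2 * π, trigEnergy v θ * ∑' k : ℕ, c k * Real.cos (k * θ) :=
    intervalIntegral.integral_mono_on_of_le_Ioo Real.two_pi_pos.le
      (Continuous.intervalIntegrable (by fun_prop) _ _)
      ((hP.mul hc).intervalIntegrable _ _)
      fun θ hθ => mul_le_mul_of_nonneg_left (hle θ hθ) (trigEnergy_nonneg v θ)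
  have hnorm : ∫ θ in (0:ℝ)..2 * π, trigEnergy v θ = 2 * π * ∑ i, v i ^ 2 := by
    simpa [Fin.val_inj, sq] using integral_trigEnergy_mul_cos v 0
  rw [integral_trigEnergy_mul_tsum hsum, intervalIntegral.integral_mul_const, hnorm] at hint
  refine le_of_mul_le_mul_left ?_ Real.two_pi_pos
  linarith
end

section
/- Let k ≥ 1 and let b_0,…,b_k and c_0,…,c_{k−1} be real numbers. Suppose that for every ℓ ∈ {1,…,k+1} the identity ∑_{j=0}^{k} b_j (x−j)^{ℓ−1} = ∑_{j=1}^{k} c_{j−1} (x−j)^{ℓ−1} holds for every real x (these are the order conditions for (k+1)-th order consistency of a k-step implicit–explicit multistep method). Then b_0 = 0 and b_j = c_{j−1} for every 1 ≤ j ≤ k. In particular, no k-step implicit–explicit multistep method with b_0 > 0 has (k+1)-th order consistency error. -/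
/-- A real sequence whose first `n` terms, placed at the nodes `x - j` with `j < n`, have
vanishing moments of every order below `n` vanishes on those terms. -/
theorem eq_zero_of_sum_mul_sub_pow_eq_zero {n : ℕ} {d : ℕ → ℝ} (x : ℝ)
    (h : ∀ i < n, ∑ j ∈ Finset.range n, d j * (x - (j : ℝ)) ^ i = 0) :
    ∀ j < n, d j = 0 := by
  have hinj : Function.Injective fun j : Fin n => x - ((j : ℕ) : ℝ) := fun i j hij =>
    Fin.ext (Nat.cast_injective (sub_right_injective hij))
  have hzero : (fun j : Fin n => d j) = 0 :=
    Matrix.eq_zero_of_forall_pow_sum_mul_pow_eq_zero hinj fun i => by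
      rw [Fin.sum_univ_eq_sum_range fun j : ℕ => d j * (x - (j : ℝ)) ^ (i : ℕ)]
      exact h i i.isLt
  exact fun j hj => congrFun hzero ⟨j, hj⟩

/-- no k-step implicit–explicit multistep method has
(k+1)-th order consistency: the order conditions force `b 0 = 0` and
`b j = c (j-1)` for `1 ≤ j ≤ k`. -/
theorem stmt7 (k : ℕ) (hk : 1 ≤ k) (b c : ℕ → ℝ)
    (horder : ∀ l ∈ Finset.Icc 1 (k + 1), ∀ x : ℝ,
      ∑ j ∈ Finset.range (k + 1), b j * (x - (j : ℝ)) ^ (l - 1) =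
        ∑ j ∈ Finset.Icc 1 k, c (j - 1) * (x - (j : ℝ)) ^ (l - 1)) :
    b 0 = 0 ∧ ∀ j ∈ Finset.Icc 1 k, b j = c (j - 1) := by
  have hdiff : ∀ j < k + 1, b j - (if j ∈ Finset.Icc 1 k then c (j - 1) else 0) = 0 := by
    refine eq_zero_of_sum_mul_sub_pow_eq_zero 0 fun i hi => ?_
    have hsub : Finset.Icc 1 k ⊆ Finset.range (k + 1) := fun j hj => by
      simp only [Finset.mem_Icc, Finset.mem_range] at hj ⊢
      lia
    have hmoment := horder (i + 1) (Finset.mem_Icc.2 ⟨by lia, by lia⟩) 0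
    rw [Nat.add_sub_cancel] at hmoment
    simp only [sub_mul, ite_mul, zero_mul, Finset.sum_sub_distrib]
    rw [Finset.sum_ite_mem, Finset.inter_eq_right.2 hsub, hmoment, sub_self]
  refine ⟨by simpa using hdiff 0 k.succ_pos, fun j hj => ?_⟩
  have hj_eq := hdiff j (Nat.lt_succ_of_le (Finset.mem_Icc.1 hj).2)
  rwa [if_pos hj, sub_eq_zero] at hj_eq
end

section
/- Fix a real parameter α ≥ 1 and define for θ ∈ [0,2π) the trigonometric polynomials a(θ) = (1/2 + α) + (1/2 − α)e^{iθ}, b(θ) = α + (1 − α)e^{iθ} and c(θ) = (α + 1) − α e^{iθ} (the semi-generating functions of the WBDF2 scheme). Then a(θ) ≠ 0 for all θ, and: max_{θ∈[0,2π)} |1/a(θ)| = 1, max_{θ∈[0,2π)} |c(θ)/a(θ)| = (2α+1)/(2α), and min_{θ∈[0,2π)} Re(b(θ)/a(θ)) = (2α−1)/(2α). Consequently the implicit–explicit controllability intensity of the WBDF2 scheme equals (2α−1)/(2α+1). -/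
open Real Set

/-- Squared modulus of a two-term semi-generating function. -/
theorem normSq_add_mul_exp (p q θ : ℝ) :
    Complex.normSq ((p : ℂ) + (q : ℂ) * Complex.exp (Complex.I * θ)) =
      p ^ 2 + q ^ 2 + 2 * p * q * cos θ := by
  rw [mul_comm Complex.I, Complex.exp_mul_I, ← Complex.ofReal_cos, ← Complex.ofReal_sin,
    Complex.normSq_apply]
  simp [-Complex.ofReal_cos, -Complex.ofReal_sin]
  linear_combination q ^ 2 * Real.sin_sq_add_cos_sq θ

/-- Real part of the quotient of two two-term semi-generating functions. -/
theorem re_add_mul_exp_div (p q r s θ : ℝ) :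
    (((p : ℂ) + (q : ℂ) * Complex.exp (Complex.I * θ)) /
      ((r : ℂ) + (s : ℂ) * Complex.exp (Complex.I * θ))).re =
      (p * r + q * s + (p * s + q * r) * cos θ) / (r ^ 2 + s ^ 2 + 2 * r * s * cos θ) := by
  rw [Complex.div_re, normSq_add_mul_exp, mul_comm Complex.I, Complex.exp_mul_I,
    ← Complex.ofReal_cos, ← Complex.ofReal_sin, ← add_div]
  congr 1
  simp [-Complex.ofReal_cos, -Complex.ofReal_sin]
  linear_combination q * s * Real.sin_sq_add_cos_sq θ

/-- factors and implicit–explicit controllability intensity of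
the α-parameterized WBDF2 scheme, for α ≥ 1. -/
theorem stmt8 (α : ℝ) (hα : 1 ≤ α) (a b c : ℝ → ℂ)
    (ha : ∀ θ : ℝ, a θ = (1/2 + (α : ℂ)) + (1/2 - (α : ℂ)) * Complex.exp (Complex.I * θ))
    (hb : ∀ θ : ℝ, b θ = (α : ℂ) + (1 - (α : ℂ)) * Complex.exp (Complex.I * θ))
    (hc : ∀ θ : ℝ, c θ = ((α : ℂ) + 1) - (α : ℂ) * Complex.exp (Complex.I * θ)) :
    (∀ θ ∈ Set.Ico (0:ℝ) (2*π), a θ ≠ 0) ∧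
    sSup ((fun θ : ℝ => ‖1 / a θ‖) '' Set.Ico (0:ℝ) (2*π)) = 1 ∧
    sSup ((fun θ : ℝ => ‖c θ / a θ‖) '' Set.Ico (0:ℝ) (2*π)) = (2*α + 1) / (2*α) ∧
    sInf ((fun θ : ℝ => (b θ / a θ).re) '' Set.Ico (0:ℝ) (2*π)) = (2*α - 1) / (2*α) ∧
    sInf ((fun θ : ℝ => (b θ / a θ).re) '' Set.Ico (0:ℝ) (2*π)) /
        sSup ((fun θ : ℝ => ‖c θ / a θ‖) '' Set.Ico (0:ℝ) (2*π)) = (2*α - 1) / (2*α + 1) := by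
  have hα0 : 0 < α := by linarith
  have h0 : (0 : ℝ) ∈ Set.Ico (0:ℝ) (2*π) := ⟨le_rfl, by positivity⟩
  have hπ : π ∈ Set.Ico (0:ℝ) (2*π) := ⟨pi_pos.le, by linarith [pi_pos]⟩
  have ha' (θ : ℝ) : a θ = ((1/2 + α : ℝ) : ℂ) +
      ((1/2 - α : ℝ) : ℂ) * Complex.exp (Complex.I * θ) := by
    rw [ha]; push_cast; ring
  have hb' (θ : ℝ) : b θ = (α : ℂ) + ((1 - α : ℝ) : ℂ) * Complex.exp (Complex.I * θ) := by
    rw [hb]; push_cast; ring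
  have hc' (θ : ℝ) : c θ = ((α + 1 : ℝ) : ℂ) +
      ((-α : ℝ) : ℂ) * Complex.exp (Complex.I * θ) := by
    rw [hc]; push_cast; ring
  have hasq (θ : ℝ) : ‖a θ‖ ^ 2 = 1/2 + 2 * α ^ 2 + (1/2 - 2 * α ^ 2) * cos θ := by
    rw [← Complex.normSq_eq_norm_sq, ha', normSq_add_mul_exp]; ring
  have hcsq (θ : ℝ) : ‖c θ‖ ^ 2 = (α + 1) ^ 2 + α ^ 2 - 2 * α * (α + 1) * cos θ := by
    rw [← Complex.normSq_eq_norm_sq, hc', normSq_add_mul_exp]; ring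
  have hre (θ : ℝ) : (b θ / a θ).re =
      (1/2 - α + 2 * α ^ 2 + (1/2 + α - 2 * α ^ 2) * cos θ) / ‖a θ‖ ^ 2 := by
    rw [hasq, ha', hb', re_add_mul_exp_div]; congr 1 <;> ring
  have ha_one (θ : ℝ) : 1 ≤ ‖a θ‖ := by
    rw [← one_le_sq_iff₀ (norm_nonneg _), hasq]
    nlinarith [cos_le_one θ, mul_nonneg (sub_nonneg.2 (cos_le_one θ))
      (show (0:ℝ) ≤ 2 * α ^ 2 - 1/2 by nlinarith)]
  have ha_pos (θ : ℝ) : 0 < ‖a θ‖ := one_pos.trans_le (ha_one θ)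
  have haπ : ‖a π‖ ^ 2 = (2 * α) ^ 2 := by rw [hasq, cos_pi]; ring
  have hσF : IsGreatest ((fun θ : ℝ => ‖1 / a θ‖) '' Set.Ico (0:ℝ) (2*π)) 1 := by
    refine ⟨⟨0, h0, ?_⟩, ?_⟩
    · have : a 0 = 1 := by rw [ha]; norm_num
      simp [this]
    · rintro _ ⟨θ, -, rfl⟩
      simpa using inv_le_one_of_one_le₀ (ha_one θ)
  have hσE : IsGreatest ((fun θ : ℝ => ‖c θ / a θ‖) '' Set.Ico (0:ℝ) (2*π))
      ((2*α + 1) / (2*α)) := by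
    refine ⟨⟨π, hπ, ?_⟩, ?_⟩
    · have hcπ : ‖c π‖ ^ 2 = (2 * α + 1) ^ 2 := by rw [hcsq, cos_pi]; ring
      simp only [norm_div]
      rw [(sq_eq_sq₀ (norm_nonneg _) (by positivity)).1 hcπ,
        (sq_eq_sq₀ (norm_nonneg _) (by positivity)).1 haπ]
    · rintro _ ⟨θ, -, rfl⟩
      simp only [norm_div]
      rw [div_le_div_iff₀ (ha_pos θ) (by positivity),
        ← sq_le_sq₀ (by positivity) (by positivity), mul_pow, mul_pow _ ‖a θ‖, hasq, hcsq]
      nlinarith [mul_nonneg (show (0:ℝ) ≤ 1 + cos θ by linarith [neg_one_le_cos θ])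
        (show (0:ℝ) ≤ 2 * α + 1/2 by linarith)]
  have hlamI : IsLeast ((fun θ : ℝ => (b θ / a θ).re) '' Set.Ico (0:ℝ) (2*π))
      ((2*α - 1) / (2*α)) := by
    refine ⟨⟨π, hπ, ?_⟩, ?_⟩
    · simp only [hre, haπ, cos_pi]
      field_simp
      ring
    · rintro _ ⟨θ, -, rfl⟩
      simp only [hre]
      rw [div_le_div_iff₀ (by positivity) (pow_pos (ha_pos θ) 2), hasq]
      nlinarith [mul_nonneg (show (0:ℝ) ≤ 1 + cos θ by linarith [neg_one_le_cos θ])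
        (show (0:ℝ) ≤ 2 * α + 1 by linarith)]
  rw [hσF.csSup_eq, hσE.csSup_eq, hlamI.csInf_eq]
  refine ⟨fun θ _ => norm_pos_iff.1 (ha_pos θ), rfl, rfl, rfl, ?_⟩
  field_simp
end

section
/- Fix a real parameter α ≥ 1 and define for θ ∈ [0,2π) the trigonometric polynomials a(θ) = (3α/2 + 1/3) + (5/6 − 2α)e^{iθ} + (α/2 − 1/6)e^{2iθ}, b(θ) = α + (1 − α)e^{iθ} and c(θ) = (2α + 1) − 3α e^{iθ} + α e^{2iθ} (the semi-generating functions of the WBDF3 scheme). Then a(θ) ≠ 0 for all θ, and: max_{θ∈[0,2π)} |1/a(θ)| = 1, max_{θ∈[0,2π)} |c(θ)/a(θ)| = 3(6α+1)/(2(6α−1)), and min_{θ∈[0,2π)} Re(b(θ)/a(θ)) = 3(2α−1)/(2(6α−1)). Consequently the implicit–explicit controllability intensity of the WBDF3 scheme equals (2α−1)/(6α+1). -/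
open Real Set

/-- Cartesian form of a quadratic trigonometric polynomial with real coefficients. -/
theorem quadratic_trig_eq (p q r θ : ℝ) :
    (p : ℂ) + q * Complex.exp (Complex.I * θ) + r * Complex.exp (2 * Complex.I * θ) =
      ⟨p + q * cos θ + r * (2 * cos θ ^ 2 - 1), q * sin θ + r * (2 * sin θ * cos θ)⟩ := by
  have h1 : Complex.exp (Complex.I * θ) = ⟨cos θ, sin θ⟩ := by
    rw [mul_comm]
    apply Complex.ext
    · exact Complex.exp_ofReal_mul_I_re θ
    · exact Complex.exp_ofReal_mul_I_im θ
  have h2 : Complex.exp (2 * Complex.I * θ) = ⟨2 * cos θ ^ 2 - 1, 2 * sin θ * cos θ⟩ := by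
    rw [← cos_two_mul, ← sin_two_mul]
    rw [show 2 * Complex.I * (θ : ℂ) = ((2 * θ : ℝ) : ℂ) * Complex.I by push_cast; ring]
    apply Complex.ext
    · exact Complex.exp_ofReal_mul_I_re (2 * θ)
    · exact Complex.exp_ofReal_mul_I_im (2 * θ)
  rw [h1, h2]
  apply Complex.ext <;> simp

/-- The squared modulus of a quadratic trigonometric polynomial is a polynomial in `cos θ`. -/
theorem normSq_quadratic_trig (p q r θ : ℝ) :
    Complex.normSq
        ⟨p + q * cos θ + r * (2 * cos θ ^ 2 - 1), q * sin θ + r * (2 * sin θ * cos θ)⟩ =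
      (p - r) ^ 2 + q ^ 2 + 2 * q * (p + r) * cos θ + 4 * p * r * cos θ ^ 2 := by
  rw [Complex.normSq_mk]
  linear_combination (q + 2 * r * cos θ) ^ 2 * sin_sq_add_cos_sq θ

/-- An affine function that is nonnegative at `-1` and `1` is nonnegative in between. -/
theorem affine_nonneg {p q x : ℝ} (h₁ : -1 ≤ x) (h₂ : x ≤ 1) (hl : 0 ≤ p - q)
    (hr : 0 ≤ p + q) : 0 ≤ p + q * x := by
  nlinarith [mul_nonneg (sub_nonneg.2 h₂) hl, mul_nonneg (neg_le_iff_add_nonneg.1 h₁) hr]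

/-- factors and implicit–explicit controllability intensity of
the α-parameterized WBDF3 scheme, for α ≥ 1. -/
theorem stmt9 (α : ℝ) (hα : 1 ≤ α) (a b c : ℝ → ℂ)
    (ha : ∀ θ : ℝ, a θ = (3*(α:ℂ)/2 + 1/3) + (5/6 - 2*(α:ℂ)) * Complex.exp (Complex.I * θ)
        + ((α:ℂ)/2 - 1/6) * Complex.exp (2 * Complex.I * θ))
    (hb : ∀ θ : ℝ, b θ = (α : ℂ) + (1 - (α:ℂ)) * Complex.exp (Complex.I * θ))
    (hc : ∀ θ : ℝ, c θ = (2*(α:ℂ) + 1) - 3*(α:ℂ) * Complex.exp (Complex.I * θ)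
        + (α:ℂ) * Complex.exp (2 * Complex.I * θ)) :
    (∀ θ ∈ Set.Ico (0:ℝ) (2*π), a θ ≠ 0) ∧
    sSup ((fun θ : ℝ => ‖1 / a θ‖) '' Set.Ico (0:ℝ) (2*π)) = 1 ∧
    sSup ((fun θ : ℝ => ‖c θ / a θ‖) '' Set.Ico (0:ℝ) (2*π)) = 3*(6*α + 1) / (2*(6*α - 1)) ∧
    sInf ((fun θ : ℝ => (b θ / a θ).re) '' Set.Ico (0:ℝ) (2*π)) = 3*(2*α - 1) / (2*(6*α - 1)) ∧
    sInf ((fun θ : ℝ => (b θ / a θ).re) '' Set.Ico (0:ℝ) (2*π)) /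
        sSup ((fun θ : ℝ => ‖c θ / a θ‖) '' Set.Ico (0:ℝ) (2*π)) = (2*α - 1) / (6*α + 1) := by
  have ha' (θ : ℝ) := quadratic_trig_eq (3 * α / 2 + 1 / 3) (5 / 6 - 2 * α) (α / 2 - 1 / 6) θ
  have hb' (θ : ℝ) := quadratic_trig_eq α (1 - α) 0 θ
  have hc' (θ : ℝ) := quadratic_trig_eq (2 * α + 1) (-(3 * α)) α θ
  push_cast at ha' hb' hc'
  simp only [zero_mul, add_zero] at hb'
  simp only [neg_mul, ← sub_eq_add_neg] at hc'
  simp only [← ha] at ha'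
  simp only [← hb] at hb'
  simp only [← hc] at hc'
  have hna (θ : ℝ) : Complex.normSq (a θ) = (α + 1 / 2) ^ 2 + (5 / 6 - 2 * α) ^ 2
      + 2 * (5 / 6 - 2 * α) * (2 * α + 1 / 6) * cos θ
      + 4 * (3 * α / 2 + 1 / 3) * (α / 2 - 1 / 6) * cos θ ^ 2 := by
    rw [ha' θ, normSq_quadratic_trig]
    ring
  have hnc (θ : ℝ) : Complex.normSq (c θ) = (α + 1) ^ 2 + (3 * α) ^ 2
      - 6 * α * (3 * α + 1) * cos θ + 4 * (2 * α + 1) * α * cos θ ^ 2 := by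
    have h := normSq_quadratic_trig (2 * α + 1) (-(3 * α)) α θ
    simp only [neg_mul, ← sub_eq_add_neg] at h
    rw [hc' θ, h]
    ring
  have ha1 (θ : ℝ) : 1 ≤ Complex.normSq (a θ) := by
    have h := affine_nonneg (p := 180 * α ^ 2 - 84 * α - 2) (q := -(108 * α ^ 2 - 12 * α - 8))
      (neg_one_le_cos θ) (cos_le_one θ) (by nlinarith) (by nlinarith)
    have := mul_nonneg (sub_nonneg.2 (cos_le_one θ)) h
    rw [hna]
    linarith
  have ha1' (θ : ℝ) : 1 ≤ ‖a θ‖ := by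
    have := ha1 θ
    rw [Complex.normSq_eq_norm_sq] at this
    nlinarith [norm_nonneg (a θ)]
  have ha0 (θ : ℝ) : a θ ≠ 0 := norm_pos_iff.1 (one_pos.trans_le (ha1' θ))
  have hK : 0 < 6 * α - 1 := by linarith
  have h0 : (0 : ℝ) ∈ Set.Ico (0 : ℝ) (2 * π) := ⟨le_rfl, two_pi_pos⟩
  have hπ : π ∈ Set.Ico (0 : ℝ) (2 * π) := ⟨pi_pos.le, by linarith [pi_pos]⟩
  have haz : a 0 = 1 := by
    rw [ha' 0]
    apply Complex.ext <;> simp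
    ring
  have haπ : a π = ((2 * (6 * α - 1) / 3 : ℝ) : ℂ) := by
    rw [ha' π]
    apply Complex.ext
    · simp only [cos_pi, Complex.ofReal_re]
      ring
    · simp
  have hbπ : b π = ((2 * α - 1 : ℝ) : ℂ) := by
    rw [hb' π]
    apply Complex.ext
    · simp only [cos_pi, Complex.ofReal_re]
      ring
    · simp
  have hcπ : c π = ((6 * α + 1 : ℝ) : ℂ) := by
    rw [hc' π]
    apply Complex.ext
    · simp only [cos_pi, Complex.ofReal_re]
      ring
    · simp
  have hF : IsGreatest ((fun θ : ℝ => ‖1 / a θ‖) '' Set.Ico (0 : ℝ) (2 * π)) 1 := by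
    refine ⟨⟨0, h0, by simp [haz]⟩, ?_⟩
    rintro _ ⟨θ, -, rfl⟩
    simpa using inv_le_one_of_one_le₀ (ha1' θ)
  have hE : IsGreatest ((fun θ : ℝ => ‖c θ / a θ‖) '' Set.Ico (0 : ℝ) (2 * π))
      (3 * (6 * α + 1) / (2 * (6 * α - 1))) := by
    refine ⟨⟨π, hπ, ?_⟩, ?_⟩
    · simp only
      rw [haπ, hcπ, ← Complex.ofReal_div, Complex.norm_real, Real.norm_of_nonneg (by positivity)]
      field_simp
    · rintro _ ⟨θ, -, rfl⟩
      have h3 : 0 < α ^ 3 := by positivity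
      have h4 : α ^ 3 ≤ α ^ 4 := pow_le_pow_right₀ hα (by norm_num)
      have h := affine_nonneg (p := 180 * α ^ 4 - 24 * α ^ 3 + 11 * α ^ 2 + 121 * α + 9 / 2)
        (q := -180 * α ^ 4 + 24 * α ^ 3 + 79 * α ^ 2 - 43 * α - 2)
        (neg_one_le_cos θ) (cos_le_one θ) (by nlinarith) (by nlinarith)
      have h := mul_nonneg (neg_le_iff_add_nonneg.1 (neg_one_le_cos θ)) h
      have hsq : (2 * (6 * α - 1) * ‖c θ‖) ^ 2 ≤ (3 * (6 * α + 1) * ‖a θ‖) ^ 2 := by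
        rw [mul_pow _ ‖c θ‖, mul_pow _ ‖a θ‖, ← Complex.normSq_eq_norm_sq, ← Complex.normSq_eq_norm_sq, hna, hnc]
        linarith
      have hle := le_of_sq_le_sq hsq (by positivity)
      simp only
      rw [norm_div, div_le_div_iff₀ (one_pos.trans_le (ha1' θ)) (by positivity)]
      linarith
  have hI : IsLeast ((fun θ : ℝ => (b θ / a θ).re) '' Set.Ico (0 : ℝ) (2 * π))
      (3 * (2 * α - 1) / (2 * (6 * α - 1))) := by
    refine ⟨⟨π, hπ, ?_⟩, ?_⟩
    · simp only
      rw [haπ, hbπ, ← Complex.ofReal_div, Complex.ofReal_re]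
      field_simp
    · rintro _ ⟨θ, -, rfl⟩
      have hre : (b θ).re * (a θ).re + (b θ).im * (a θ).im =
          α * (α + 1 / 2) + (5 / 6 - 2 * α) * (1 - α)
          + ((5 / 6 - 2 * α) * α + (2 * α + 1 / 6) * (1 - α)) * cos θ
          + 2 * α * (α / 2 - 1 / 6) * cos θ ^ 2 := by
        rw [ha' θ, hb' θ]
        simp only
        linear_combination (1 - α) * (5 / 6 - 2 * α + 2 * (α / 2 - 1 / 6) * cos θ) *
          sin_sq_add_cos_sq θ
      have hq : 18 * α ^ 3 - 15 * α ^ 2 - 3 * α + 2 ≥ 0 := by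
        nlinarith [mul_nonneg (sq_nonneg α) (sub_nonneg.2 hα)]
      have h := affine_nonneg
        (p := (6 * α + 1) / 2 + (18 * α ^ 3 - 15 * α ^ 2 - 3 * α + 2) / 3)
        (q := -(18 * α ^ 3 - 15 * α ^ 2 - 3 * α + 2) / 3)
        (neg_one_le_cos θ) (cos_le_one θ) (by linarith) (by linarith)
      have h := mul_nonneg (neg_le_iff_add_nonneg.1 (neg_one_le_cos θ)) h
      simp only
      rw [Complex.div_re, ← add_div, div_le_div_iff₀ (by positivity)
        (one_pos.trans_le (ha1 θ)), hre, hna]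
      linarith
  rw [hF.csSup_eq, hE.csSup_eq, hI.csInf_eq]
  refine ⟨fun θ _ => ha0 θ, rfl, rfl, rfl, ?_⟩
  rw [div_div_div_cancel_right₀ (by positivity), mul_div_mul_left _ _ three_ne_zero]
end

section
/- Fix a real parameter α and define for θ ∈ [0,2π) the trigonometric polynomials a(θ) = (22α+3)/12 + ((13−36α)/12)e^{iθ} + ((18α−5)/12)e^{2iθ} + ((1−4α)/12)e^{3iθ}, b(θ) = α + (1 − α)e^{iθ} and c(θ) = (3α + 1) − 6α e^{iθ} + 4α e^{2iθ} − α e^{3iθ} (the semi-generating functions of the WBDF4 scheme). If α ≥ 1 then a(θ) ≠ 0 for all θ and: max_{θ∈[0,2π)} |1/a(θ)| ≥ 1, max_{θ∈[0,2π)} |c(θ)/a(θ)| ≥ 3(14α+1)/(4(5α−1)), and min_{θ∈[0,2π)} Re(b(θ)/a(θ)) ≤ 3(2α−1)/(4(5α−1)), so the implicit–explicit controllability intensity is at most (2α−1)/(14α+1). If moreover α ≥ 6/5 then equalities hold: max_θ |1/a(θ)| = 1, max_θ |c(θ)/a(θ)| = 3(14α+1)/(4(5α−1)), min_θ Re(b(θ)/a(θ))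 = 3(2α−1)/(4(5α−1)), and the implicit–explicit controllability intensity equals (2α−1)/(14α+1). -/
open Real Set

/-- The real part of `a` at a point with `cos θ = x`, `sin θ = y`. -/
noncomputable def aRe (α x y : ℝ) : ℝ :=
  ((22 * α + 3) + (13 - 36 * α) * x + (18 * α - 5) * (x ^ 2 - y ^ 2)
    + (1 - 4 * α) * (x ^ 3 - 3 * x * y ^ 2)) / 12

/-- The imaginary part of `a` at a point with `cos θ = x`, `sin θ = y`. -/
noncomputable def aIm (α x y : ℝ) : ℝ :=
  ((13 - 36 * α) * y + (18 * α - 5) * (2 * x * y) + (1 - 4 * α) * (3 * x ^ 2 * y - y ^ 3)) / 12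

/-- The real part of `c` at a point with `cos θ = x`, `sin θ = y`. -/
noncomputable def cRe (α x y : ℝ) : ℝ :=
  (3 * α + 1) - 6 * α * x + 4 * α * (x ^ 2 - y ^ 2) - α * (x ^ 3 - 3 * x * y ^ 2)

/-- The imaginary part of `c` at a point with `cos θ = x`, `sin θ = y`. -/
noncomputable def cIm (α x y : ℝ) : ℝ :=
  -(6 * α * y) + 4 * α * (2 * x * y) - α * (3 * x ^ 2 * y - y ^ 3)

lemma aRe_sq_add_aIm_sq {α x y : ℝ} (h : x ^ 2 + y ^ 2 = 1) :
    aRe α x y ^ 2 + aIm α x y ^ 2 =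
      (-44 / 9 * α ^ 2 + 5 / 9 * α + 1 / 6) * x ^ 3 + (15 * α ^ 2 - 4 * α - 1 / 18) * x ^ 2
        + (-52 / 3 * α ^ 2 + 25 / 3 * α - 5 / 9) * x + (65 / 9 * α ^ 2 - 44 / 9 * α + 13 / 9) := by
  have h' : y ^ 2 = 1 - x ^ 2 := by linarith
  unfold aRe aIm
  grind

lemma cRe_sq_add_cIm_sq {α x y : ℝ} (h : x ^ 2 + y ^ 2 = 1) :
    9 * (14 * α + 1) ^ 2 * (aRe α x y ^ 2 + aIm α x y ^ 2)
        - 16 * (5 * α - 1) ^ 2 * (cRe α x y ^ 2 + cIm α x y ^ 2) =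
      (976 * α ^ 4 - 892 * α ^ 3 - 506 * α ^ 2 + 175 * α + 3 / 2) * x ^ 3
        + (-2340 * α ^ 4 + 1844 * α ^ 3 + 437 * α ^ 2 - 306 * α - 1 / 2) * x ^ 2
        + (-976 * α ^ 4 + 892 * α ^ 3 + 1188 * α ^ 2 + 31 * α - 5) * x
        + (2340 * α ^ 4 - 1844 * α ^ 3 + 245 * α ^ 2 + 512 * α - 3) := by
  rw [aRe_sq_add_aIm_sq h]
  have h' : y ^ 2 = 1 - x ^ 2 := by linarith
  unfold cRe cIm
  grind

lemma re_mul_sub {α x y : ℝ} (h : x ^ 2 + y ^ 2 = 1) :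
    4 * (5 * α - 1) * ((α + (1 - α) * x) * aRe α x y + (1 - α) * y * aIm α x y)
        - 3 * (2 * α - 1) * (aRe α x y ^ 2 + aIm α x y ^ 2) =
      (8 / 3 * α ^ 3 - 6 * α ^ 2 - 2 / 3 * α + 1 / 2) * x ^ 3
        + (-50 / 3 * α ^ 3 + 21 * α ^ 2 - 5 / 3 * α - 5 / 6) * x ^ 2
        + (-8 / 3 * α ^ 3 + 6 * α ^ 2 + 23 / 3 * α - 1) * x
        + (50 / 3 * α ^ 3 - 21 * α ^ 2 + 26 / 3 * α + 1 / 3) := by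
  rw [aRe_sq_add_aIm_sq h]
  have h' : y ^ 2 = 1 - x ^ 2 := by linarith
  unfold aRe aIm
  grind

lemma one_le_aRe_sq_add_aIm_sq {α x y : ℝ} (hα : 1 ≤ α) (h : x ^ 2 + y ^ 2 = 1) :
    1 ≤ aRe α x y ^ 2 + aIm α x y ^ 2 := by
  rw [aRe_sq_add_aIm_sq h]
  obtain ⟨s, rfl⟩ : ∃ s, α = 1 + s := ⟨α - 1, by ring⟩
  obtain ⟨u, rfl⟩ : ∃ u, x = 1 - u := ⟨1 - x, by ring⟩
  have hs : 0 ≤ s := by linarith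
  have hu : 0 ≤ u := by nlinarith [sq_nonneg y]
  have hq : 0 ≤ (44 / 9 * s ^ 2 + 83 / 9 * s + 25 / 6) * u ^ 2
      + (1 / 3 * s ^ 2 - 5 / 3 * s - 14 / 9) * u + (2 * s ^ 2 + 2 * s + 1 / 6) := by
    have h0 : 0 ≤ (25 / 6 : ℝ) * u ^ 2 - 14 / 9 * u + 1 / 6 := by
      nlinarith [sq_nonneg (u - 14 / 75)]
    have h1 : 0 ≤ (83 / 9 : ℝ) * u ^ 2 - 5 / 3 * u + 2 := by
      nlinarith [sq_nonneg (u - 1 / 10)]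
    have h2 : 0 ≤ (44 / 9 : ℝ) * u ^ 2 + 1 / 3 * u + 2 := by positivity
    nlinarith [mul_nonneg hs h1, mul_nonneg (sq_nonneg s) h2]
  nlinarith [mul_nonneg hu hq]

lemma cRe_sq_add_cIm_sq_le {α x y : ℝ} (hα : 6 / 5 ≤ α) (h : x ^ 2 + y ^ 2 = 1) :
    16 * (5 * α - 1) ^ 2 * (cRe α x y ^ 2 + cIm α x y ^ 2) ≤
      9 * (14 * α + 1) ^ 2 * (aRe α x y ^ 2 + aIm α x y ^ 2) := by
  rw [← sub_nonneg, cRe_sq_add_cIm_sq h]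
  obtain ⟨s, rfl⟩ : ∃ s, α = 6 / 5 + s := ⟨α - 6 / 5, by ring⟩
  obtain ⟨w, rfl⟩ : ∃ w, x = w - 1 := ⟨1 + x, by ring⟩
  have hs : 0 ≤ s := by linarith
  have hw : 0 ≤ w := by nlinarith [sq_nonneg y]
  have hw2 : 0 ≤ 2 - w := by nlinarith [sq_nonneg y]
  have h4 : 0 ≤ 976 * w ^ 2 - 5268 * w + 6632 := by nlinarith
  have h3 : 0 ≤ 18964 / 5 * w ^ 2 - 103832 / 5 * w + 131808 / 5 := by nlinarith
  have h2 : 0 ≤ 117886 / 25 * w ^ 2 - 682213 / 25 * w + 909932 / 25 := by nlinarith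
  have h1 : 0 ≤ 231659 / 125 * w ^ 2 - 1628127 / 125 * w + 2559968 / 125 := by nlinarith
  have h0 : 0 ≤ -43353 / 1250 * w ^ 2 - 812603 / 625 * w + 4956049 / 1250 := by nlinarith
  have hq : 0 ≤ w * ((976 * w ^ 2 - 5268 * w + 6632) * s ^ 4
      + (18964 / 5 * w ^ 2 - 103832 / 5 * w + 131808 / 5) * s ^ 3
      + (117886 / 25 * w ^ 2 - 682213 / 25 * w + 909932 / 25) * s ^ 2
      + (231659 / 125 * w ^ 2 - 1628127 / 125 * w + 2559968 / 125) * s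
      + (-43353 / 1250 * w ^ 2 - 812603 / 625 * w + 4956049 / 1250)) := by positivity
  linarith

lemma le_re_mul {α x y : ℝ} (hα : 6 / 5 ≤ α) (h : x ^ 2 + y ^ 2 = 1) :
    3 * (2 * α - 1) * (aRe α x y ^ 2 + aIm α x y ^ 2) ≤
      4 * (5 * α - 1) * ((α + (1 - α) * x) * aRe α x y + (1 - α) * y * aIm α x y) := by
  rw [← sub_nonneg, re_mul_sub h]
  obtain ⟨s, rfl⟩ : ∃ s, α = 6 / 5 + s := ⟨α - 6 / 5, by ring⟩
  obtain ⟨w, rfl⟩ : ∃ w, x = w - 1 := ⟨1 + x, by ring⟩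
  have hs : 0 ≤ s := by linarith
  have hw : 0 ≤ w := by nlinarith [sq_nonneg y]
  have hw2 : 0 ≤ 2 - w := by nlinarith [sq_nonneg y]
  have h3 : 0 ≤ 8 / 3 * w ^ 2 - 74 / 3 * w + 116 / 3 := by nlinarith
  have h2 : 0 ≤ 18 / 5 * w ^ 2 - 249 / 5 * w + 426 / 5 := by nlinarith
  have h1 : 0 ≤ -266 / 75 * w ^ 2 - 947 / 75 * w + 1161 / 25 := by nlinarith
  have h0 : 0 ≤ -1083 / 250 * w ^ 2 + 4351 / 375 * w + 1517 / 750 := by nlinarith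
  have hq : 0 ≤ w * ((8 / 3 * w ^ 2 - 74 / 3 * w + 116 / 3) * s ^ 3
      + (18 / 5 * w ^ 2 - 249 / 5 * w + 426 / 5) * s ^ 2
      + (-266 / 75 * w ^ 2 - 947 / 75 * w + 1161 / 25) * s
      + (-1083 / 250 * w ^ 2 + 4351 / 375 * w + 1517 / 750)) := by positivity
  linarith

lemma exp_I_mul_eq (θ : ℝ) : Complex.exp (Complex.I * θ) = ⟨cos θ, sin θ⟩ := by
  rw [mul_comm, Complex.exp_mul_I]
  apply Complex.ext <;> simp [Complex.cos_ofReal_re, Complex.sin_ofReal_re]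

lemma exp_two_I_mul_eq (θ : ℝ) :
    Complex.exp (2 * Complex.I * θ) = (⟨cos θ, sin θ⟩ : ℂ) ^ 2 := by
  rw [← exp_I_mul_eq, ← Complex.exp_nat_mul]
  congr 1
  push_cast
  ring

lemma exp_three_I_mul_eq (θ : ℝ) :
    Complex.exp (3 * Complex.I * θ) = (⟨cos θ, sin θ⟩ : ℂ) ^ 3 := by
  rw [← exp_I_mul_eq, ← Complex.exp_nat_mul]
  congr 1
  push_cast
  ring

/-- factors and implicit–explicit controllability intensity of
the α-parameterized WBDF4 scheme: bounds for α ≥ 1 and equalities for α ≥ 6/5. -/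
theorem stmt10 (α : ℝ) (a b c : ℝ → ℂ)
    (ha : ∀ θ : ℝ, a θ = ((22*(α:ℂ) + 3)/12) + ((13 - 36*(α:ℂ))/12) * Complex.exp (Complex.I * θ)
        + ((18*(α:ℂ) - 5)/12) * Complex.exp (2 * Complex.I * θ)
        + ((1 - 4*(α:ℂ))/12) * Complex.exp (3 * Complex.I * θ))
    (hb : ∀ θ : ℝ, b θ = (α : ℂ) + (1 - (α:ℂ)) * Complex.exp (Complex.I * θ))
    (hc : ∀ θ : ℝ, c θ = (3*(α:ℂ) + 1) - 6*(α:ℂ) * Complex.exp (Complex.I * θ)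
        + 4*(α:ℂ) * Complex.exp (2 * Complex.I * θ)
        - (α:ℂ) * Complex.exp (3 * Complex.I * θ)) :
    (1 ≤ α →
      (∀ θ ∈ Set.Ico (0:ℝ) (2*π), a θ ≠ 0) ∧
      1 ≤ sSup ((fun θ : ℝ => ‖1 / a θ‖) '' Set.Ico (0:ℝ) (2*π)) ∧
      3*(14*α + 1) / (4*(5*α - 1)) ≤
        sSup ((fun θ : ℝ => ‖c θ / a θ‖) '' Set.Ico (0:ℝ) (2*π)) ∧
      sInf ((fun θ : ℝ => (b θ / a θ).re) '' Set.Ico (0:ℝ) (2*π)) ≤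
        3*(2*α - 1) / (4*(5*α - 1)) ∧
      sInf ((fun θ : ℝ => (b θ / a θ).re) '' Set.Ico (0:ℝ) (2*π)) /
          sSup ((fun θ : ℝ => ‖c θ / a θ‖) '' Set.Ico (0:ℝ) (2*π)) ≤
        (2*α - 1) / (14*α + 1)) ∧
    (6/5 ≤ α →
      sSup ((fun θ : ℝ => ‖1 / a θ‖) '' Set.Ico (0:ℝ) (2*π)) = 1 ∧
      sSup ((fun θ : ℝ => ‖c θ / a θ‖) '' Set.Ico (0:ℝ) (2*π)) =
        3*(14*α + 1) / (4*(5*α - 1)) ∧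
      sInf ((fun θ : ℝ => (b θ / a θ).re) '' Set.Ico (0:ℝ) (2*π)) =
        3*(2*α - 1) / (4*(5*α - 1)) ∧
      sInf ((fun θ : ℝ => (b θ / a θ).re) '' Set.Ico (0:ℝ) (2*π)) /
          sSup ((fun θ : ℝ => ‖c θ / a θ‖) '' Set.Ico (0:ℝ) (2*π)) =
        (2*α - 1) / (14*α + 1)) := by
  have a_eq (θ : ℝ) : a θ = ⟨aRe α (cos θ) (sin θ), aIm α (cos θ) (sin θ)⟩ := by
    rw [ha, exp_I_mul_eq, exp_two_I_mul_eq, exp_three_I_mul_eq, Complex.mk_eq_add_mul_I,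
      Complex.mk_eq_add_mul_I]
    simp only [aRe, aIm]
    push_cast
    linear_combination (((18 * (α : ℂ) - 5) / 12) * Complex.sin θ ^ 2 +
      ((1 - 4 * (α : ℂ)) / 12) * (3 * Complex.cos θ * Complex.sin θ ^ 2 +
        Complex.sin θ ^ 3 * Complex.I)) * Complex.I_sq
  have c_eq (θ : ℝ) : c θ = ⟨cRe α (cos θ) (sin θ), cIm α (cos θ) (sin θ)⟩ := by
    rw [hc, exp_I_mul_eq, exp_two_I_mul_eq, exp_three_I_mul_eq, Complex.mk_eq_add_mul_I,
      Complex.mk_eq_add_mul_I]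
    simp only [cRe, cIm]
    push_cast
    linear_combination (4 * (α : ℂ) * Complex.sin θ ^ 2 -
      (α : ℂ) * (3 * Complex.cos θ * Complex.sin θ ^ 2 +
        Complex.sin θ ^ 3 * Complex.I)) * Complex.I_sq
  have b_eq (θ : ℝ) : b θ = ⟨α + (1 - α) * cos θ, (1 - α) * sin θ⟩ := by
    rw [hb, exp_I_mul_eq, Complex.mk_eq_add_mul_I, Complex.mk_eq_add_mul_I]
    push_cast
    ring
  have norm_a (θ : ℝ) :
      ‖a θ‖ ^ 2 = aRe α (cos θ) (sin θ) ^ 2 + aIm α (cos θ) (sin θ) ^ 2 := by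
    rw [a_eq, Complex.sq_norm, Complex.normSq_mk]
    ring
  have norm_c (θ : ℝ) :
      ‖c θ‖ ^ 2 = cRe α (cos θ) (sin θ) ^ 2 + cIm α (cos θ) (sin θ) ^ 2 := by
    rw [c_eq, Complex.sq_norm, Complex.normSq_mk]
    ring
  have re_b_div_a (θ : ℝ) : (b θ / a θ).re = ((α + (1 - α) * cos θ) * aRe α (cos θ) (sin θ) +
      (1 - α) * sin θ * aIm α (cos θ) (sin θ)) / ‖a θ‖ ^ 2 := by
    rw [Complex.div_re, Complex.sq_norm, b_eq, a_eq, ← add_div]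
  have zero_mem : (0 : ℝ) ∈ Ico 0 (2 * π) := ⟨le_rfl, by positivity⟩
  have pi_mem : π ∈ Ico 0 (2 * π) := ⟨pi_pos.le, by linarith [pi_pos]⟩
  have a_zero : ‖1 / a 0‖ = 1 := by
    rw [ha]
    norm_num
    rw [← norm_one (α := ℂ)]
    congr 1
    ring
  have a_pi : a π = ((4 * (5 * α - 1) / 3 : ℝ) : ℂ) := by
    rw [a_eq]
    apply Complex.ext <;> simp [aRe, aIm] <;> ring
  have c_pi : c π = ((14 * α + 1 : ℝ) : ℂ) := by
    rw [c_eq]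
    apply Complex.ext <;> simp [cRe, cIm]
    ring
  have b_pi : b π = ((2 * α - 1 : ℝ) : ℂ) := by
    rw [b_eq]
    apply Complex.ext <;> simp
    ring
  have one_le_norm_a (hα : 1 ≤ α) (θ : ℝ) : 1 ≤ ‖a θ‖ := by
    have := one_le_aRe_sq_add_aIm_sq hα (cos_sq_add_sin_sq θ)
    rw [← norm_a] at this
    nlinarith [norm_nonneg (a θ)]
  have c_div_a_pi (hα : 1 ≤ α) : ‖c π / a π‖ = 3 * (14 * α + 1) / (4 * (5 * α - 1)) := by
    have h1 : 0 < 5 * α - 1 := by linarith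
    rw [c_pi, a_pi, ← Complex.ofReal_div, Complex.norm_real, Real.norm_of_nonneg (by positivity)]
    field_simp
  have b_div_a_pi (hα : 1 ≤ α) : (b π / a π).re = 3 * (2 * α - 1) / (4 * (5 * α - 1)) := by
    have h1 : 0 < 5 * α - 1 := by linarith
    rw [b_pi, a_pi, ← Complex.ofReal_div, Complex.ofReal_re]
    field_simp
  have continuous_a : Continuous a := by
    rw [funext ha]
    fun_prop
  have continuous_b : Continuous b := by
    rw [funext hb]
    fun_prop
  have continuous_c : Continuous c := by
    rw [funext hc]
    fun_prop
  refine ⟨fun hα ↦ ?_, fun hα ↦ ?_⟩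
  · have a_ne (θ : ℝ) : a θ ≠ 0 := norm_pos_iff.1 (by linarith [one_le_norm_a hα θ])
    have bdd_of_continuous {f : ℝ → ℝ} (hf : Continuous f) :
        BddAbove (f '' Ico 0 (2 * π)) ∧ BddBelow (f '' Ico 0 (2 * π)) :=
      have h := isCompact_Icc.image (s := Icc 0 (2 * π)) hf
      ⟨h.bddAbove.mono (image_mono Ico_subset_Icc_self),
        h.bddBelow.mono (image_mono Ico_subset_Icc_self)⟩
    have hc_sup := le_csSup (bdd_of_continuous (continuous_c.div continuous_a a_ne).norm).1
      (mem_image_of_mem _ pi_mem)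
    have hb_inf := csInf_le (bdd_of_continuous
      (Complex.continuous_re.comp (continuous_b.div continuous_a a_ne))).2
      (mem_image_of_mem _ pi_mem)
    have ha_sup := le_csSup (bdd_of_continuous (continuous_const.div continuous_a a_ne).norm).1
      (mem_image_of_mem (fun θ ↦ ‖1 / a θ‖) zero_mem)
    simp only [Function.comp_apply, Pi.div_apply] at hc_sup hb_inf ha_sup
    rw [c_div_a_pi hα] at hc_sup
    rw [b_div_a_pi hα] at hb_inf
    rw [a_zero] at ha_sup
    refine ⟨fun θ _ ↦ a_ne θ, ha_sup, hc_sup, hb_inf, ?_⟩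
    have h1 : 0 < 5 * α - 1 := by linarith
    have h2 : 0 < 2 * α - 1 := by linarith
    have h3 : 0 < 14 * α + 1 := by linarith
    calc _ ≤ (3 * (2 * α - 1) / (4 * (5 * α - 1))) / (3 * (14 * α + 1) / (4 * (5 * α - 1))) :=
          div_le_div₀ (by positivity) hb_inf (by positivity) hc_sup
      _ = _ := by
          rw [div_div_div_cancel_right₀ (by positivity), mul_div_mul_left _ _ three_ne_zero]
  · have hα' : 1 ≤ α := by linarith
    have h1 : 0 < 5 * α - 1 := by linarith
    have h3 : 0 < 14 * α + 1 := by linarith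
    have norm_a_pos (θ : ℝ) : 0 < ‖a θ‖ := by linarith [one_le_norm_a hα' θ]
    have ha_sup : IsGreatest ((fun θ : ℝ ↦ ‖1 / a θ‖) '' Ico 0 (2 * π)) 1 := by
      refine ⟨⟨0, zero_mem, a_zero⟩, ?_⟩
      rintro _ ⟨θ, -, rfl⟩
      simpa using inv_le_one_of_one_le₀ (one_le_norm_a hα' θ)
    have hc_sup : IsGreatest ((fun θ : ℝ ↦ ‖c θ / a θ‖) '' Ico 0 (2 * π))
        (3 * (14 * α + 1) / (4 * (5 * α - 1))) := by
      refine ⟨⟨π, pi_mem, c_div_a_pi hα'⟩, ?_⟩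
      rintro _ ⟨θ, -, rfl⟩
      have h := cRe_sq_add_cIm_sq_le hα (cos_sq_add_sin_sq θ)
      rw [← norm_a, ← norm_c] at h
      simp only [norm_div]
      rw [div_le_div_iff₀ (norm_a_pos θ) (by positivity)]
      refine (pow_le_pow_iff_left₀ (by positivity) (by positivity) two_ne_zero).1 ?_
      linarith
    have hb_inf : IsLeast ((fun θ : ℝ ↦ (b θ / a θ).re) '' Ico 0 (2 * π))
        (3 * (2 * α - 1) / (4 * (5 * α - 1))) := by
      refine ⟨⟨π, pi_mem, b_div_a_pi hα'⟩, ?_⟩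
      rintro _ ⟨θ, -, rfl⟩
      have h := le_re_mul hα (cos_sq_add_sin_sq θ)
      rw [← norm_a] at h
      simp only [re_b_div_a]
      rw [div_le_div_iff₀ (by positivity) (pow_pos (norm_a_pos θ) 2)]
      linarith
    rw [ha_sup.csSup_eq, hc_sup.csSup_eq, hb_inf.csInf_eq]
    refine ⟨rfl, rfl, rfl, ?_⟩
    rw [div_div_div_cancel_right₀ (by positivity), mul_div_mul_left _ _ three_ne_zero]
end

section
/- Fix a real parameter δ ≥ 2 and define for θ ∈ [0,2π) the trigonometric polynomials a(θ) = (3δ² − 3δ/2 + 1/3) − (6δ² − 6δ + 7/6)e^{iθ} + (3δ² − 9δ/2 + 11/6)e^{2iθ}, b(θ) = δ³ + 3δ²(1−δ)e^{iθ} + 3δ(1−δ)²e^{2iθ} + (1−δ)³e^{3iθ} and c(θ) = 3δ² + 3δ(1−2δ)e^{iθ} + (3δ² − 3δ + 1)e^{2iθ} (the semi-generating functions of the NIMEX3 scheme). Then a(θ) ≠ 0 for all θ, and: max_{θ∈[0,2π)} |1/a(θ)| = 1, max_{θ∈[0,2π)} |c(θ)/a(θ)| = (36δ² − 18δ + 3)/(36δ²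 − 36δ + 10), and min_{θ∈[0,2π)} Re(b(θ)/a(θ)) ≥ (24δ² − 21δ + 3)/(36δ² − 36δ + 10); consequently the implicit–explicit controllability intensity is at least (24δ² − 21δ + 3)/(36δ² − 18δ + 3). -/
open Real Set

namespace NIMEX3

/-- The time-derivative polynomial of the scheme, whose value at `exp (i θ)` is `a(θ)`. -/
noncomputable def derivPoly (δ : ℝ) (z : ℂ) : ℂ :=
  ((3*δ^2 - 3*δ/2 + 1/3 : ℝ) : ℂ) + ((-(6*δ^2 - 6*δ + 7/6) : ℝ) : ℂ) * z
    + ((3*δ^2 - 9*δ/2 + 11/6 : ℝ) : ℂ) * z^2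

/-- The implicit polynomial of the scheme, whose value at `exp (i θ)` is `b(θ)`. -/
noncomputable def implicitPoly (δ : ℝ) (z : ℂ) : ℂ :=
  ((δ^3 : ℝ) : ℂ) + ((3*δ^2*(1 - δ) : ℝ) : ℂ) * z + ((3*δ*(1 - δ)^2 : ℝ) : ℂ) * z^2
    + (((1 - δ)^3 : ℝ) : ℂ) * z^3

/-- The explicit polynomial of the scheme, whose value at `exp (i θ)` is `c(θ)`. -/
noncomputable def explicitPoly (δ : ℝ) (z : ℂ) : ℂ :=
  ((3*δ^2 : ℝ) : ℂ) + ((3*δ*(1 - 2*δ) : ℝ) : ℂ) * z + ((3*δ^2 - 3*δ + 1 : ℝ) : ℂ) * z^2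

theorem normSq_quadratic (p q r : ℝ) {z : ℂ} (hz : Complex.normSq z = 1) :
    Complex.normSq ((p : ℂ) + q * z + r * z^2) =
      p^2 + q^2 + r^2 + 2*(p*q + q*r)*z.re + 2*p*r*(2*z.re^2 - 1) := by
  obtain ⟨x, y⟩ := z
  simp only [Complex.normSq_apply] at hz
  simp [Complex.normSq_apply, pow_two]
  linear_combination (q^2 + r^2*(x*x + y*y + 1) + 2*q*r*x - 2*p*r) * hz

theorem re_cubic_mul_conj_quadratic (s t v w p q r : ℝ) {z : ℂ} (hz : Complex.normSq z = 1) :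
    (((s : ℂ) + t * z + v * z^2 + w * z^3) *
        (starRingEnd ℂ) ((p : ℂ) + q * z + r * z^2)).re =
      s*p + t*q + v*r + (s*q + t*p + t*r + v*q + w*r)*z.re
        + (s*r + v*p + w*q)*(2*z.re^2 - 1) + w*p*(4*z.re^3 - 3*z.re) := by
  obtain ⟨x, y⟩ := z
  simp only [Complex.normSq_apply] at hz
  simp [pow_succ]
  linear_combination (t*q + v*r*(x*x + y*y + 1) + (t*r + v*q)*x + w*r*x*(x*x + y*y + 1)
    + w*q*(x*x - y*y) - (s*r + v*p + w*q) - 3*w*p*x) * hz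

theorem normSq_derivPoly {δ : ℝ} {z : ℂ} (hz : Complex.normSq z = 1) :
    Complex.normSq (derivPoly δ z) = 1 + (1 - z.re) * ((6*(δ - 2)^2 + 18*(δ - 2) + 73/6)
      + (36*(δ - 2)^4 + 216*(δ - 2)^3 + 485*(δ - 2)^2 + 483*(δ - 2) + 1624/9) * (1 - z.re)) := by
  rw [derivPoly, normSq_quadratic _ _ _ hz]
  ring

theorem one_le_normSq_derivPoly {δ : ℝ} (hδ : 2 ≤ δ) {z : ℂ} (hz : Complex.normSq z = 1)
    (hx : z.re ≤ 1) : 1 ≤ Complex.normSq (derivPoly δ z) := by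
  rw [normSq_derivPoly hz]
  have hd : 0 ≤ δ - 2 := sub_nonneg.2 hδ
  have hu : 0 ≤ 1 - z.re := sub_nonneg.2 hx
  generalize δ - 2 = d at *
  generalize 1 - z.re = u at *
  exact le_add_of_nonneg_right (by positivity)

theorem normSq_explicitPoly_le {δ : ℝ} (hδ : 2 ≤ δ) {z : ℂ} (hz : Complex.normSq z = 1)
    (hx : z.re ≤ 1) (hx' : -1 ≤ z.re) :
    (36*δ^2 - 36*δ + 10)^2 * Complex.normSq (explicitPoly δ z) ≤
      (36*δ^2 - 18*δ + 3)^2 * Complex.normSq (derivPoly δ z) := by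
  rw [normSq_derivPoly hz, explicitPoly, normSq_quadratic _ _ _ hz]
  obtain ⟨d, rfl⟩ : ∃ d, δ = d + 2 := ⟨δ - 2, by ring⟩
  have hd : 0 ≤ d := by linarith
  obtain ⟨u, hu⟩ : ∃ u, z.re = 1 - u := ⟨1 - z.re, by ring⟩
  rw [hu] at hx hx' ⊢
  have hu₀ : 0 ≤ u := by linarith
  have hu₂ : 0 ≤ 2 - u := by linarith
  have key : 0 ≤ (2 - u) * (648*d^3 + 3150*d^2 + 5130*d + 5597/2
      + (3888*d^5 + 30672*d^4 + 96336*d^3 + 150495*d^2 + 116829*d + 36008) * u) := by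
    positivity
  linear_combination key

theorem dissipation_bound {δ : ℝ} (hδ : 2 ≤ δ) {z : ℂ} (hz : Complex.normSq z = 1)
    (hx : z.re ≤ 1) :
    (24*δ^2 - 21*δ + 3) * Complex.normSq (derivPoly δ z) ≤
      (36*δ^2 - 36*δ + 10) *
        (implicitPoly δ z * (starRingEnd ℂ) (derivPoly δ z)).re := by
  rw [normSq_derivPoly hz, derivPoly, implicitPoly,
    re_cubic_mul_conj_quadratic _ _ _ _ _ _ _ hz]
  obtain ⟨d, rfl⟩ : ∃ d, δ = d + 2 := ⟨δ - 2, by ring⟩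
  have hd : 0 ≤ d := by linarith
  obtain ⟨u, hu⟩ : ∃ u, z.re = 1 - u := ⟨1 - z.re, by ring⟩
  rw [hu] at hx ⊢
  have hu₀ : 0 ≤ u := by linarith
  obtain ⟨P, hP⟩ : ∃ P, P = 72*d^4 + 414*d^3 + 878*d^2 + 1631/2*d + 1661/6 := ⟨_, rfl⟩
  obtain ⟨Q, hQ⟩ : ∃ Q, Q = 180*d^5 + 1428*d^4 + 4535*d^3 + 21566/3*d^2 + 17035/3*d + 5354/3 :=
    ⟨_, rfl⟩
  obtain ⟨R, hR⟩ : ∃ R, R = 432*d^7 + 4104*d^6 + 16584*d^5 + 36924*d^4 + 146668/3*d^3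
    + 38476*d^2 + 16660*d + 9184/3 := ⟨_, rfl⟩
  have hR₀ : 0 < R := by rw [hR]; positivity
  have hdisc : Q^2 ≤ 4*P*R := by
    rw [← sub_nonneg, hP, hQ, hR]
    ring_nf
    positivity
  have hquad : 0 ≤ P - Q*u + R*u^2 := by
    nlinarith [sq_nonneg (2*R*u - Q)]
  have key : 0 ≤ 12*d^2 + 33*d + 25 + u * (P - Q*u + R*u^2) := by positivity
  rw [hP, hQ, hR] at key
  linear_combination key

end NIMEX3

open NIMEX3

/-- factors and lower bound on the implicit–explicit
controllability intensity of the δ-parameterized NIMEX3 scheme, for δ ≥ 2. -/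
theorem stmt13 (δ : ℝ) (hδ : 2 ≤ δ) (a b c : ℝ → ℂ)
    (ha : ∀ θ : ℝ, a θ = (3*(δ:ℂ)^2 - 3*(δ:ℂ)/2 + 1/3)
        - (6*(δ:ℂ)^2 - 6*(δ:ℂ) + 7/6) * Complex.exp (Complex.I * θ)
        + (3*(δ:ℂ)^2 - 9*(δ:ℂ)/2 + 11/6) * Complex.exp (2 * Complex.I * θ))
    (hb : ∀ θ : ℝ, b θ = (δ:ℂ)^3 + 3*(δ:ℂ)^2*(1 - (δ:ℂ)) * Complex.exp (Complex.I * θ)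
        + 3*(δ:ℂ)*(1 - (δ:ℂ))^2 * Complex.exp (2 * Complex.I * θ)
        + (1 - (δ:ℂ))^3 * Complex.exp (3 * Complex.I * θ))
    (hc : ∀ θ : ℝ, c θ = 3*(δ:ℂ)^2 + 3*(δ:ℂ)*(1 - 2*(δ:ℂ)) * Complex.exp (Complex.I * θ)
        + (3*(δ:ℂ)^2 - 3*(δ:ℂ) + 1) * Complex.exp (2 * Complex.I * θ)) :
    (∀ θ ∈ Set.Ico (0:ℝ) (2*π), a θ ≠ 0) ∧
    sSup ((fun θ : ℝ => ‖1 / a θ‖) '' Set.Ico (0:ℝ) (2*π)) = 1 ∧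
    sSup ((fun θ : ℝ => ‖c θ / a θ‖) '' Set.Ico (0:ℝ) (2*π)) =
      (36*δ^2 - 18*δ + 3) / (36*δ^2 - 36*δ + 10) ∧
    (24*δ^2 - 21*δ + 3) / (36*δ^2 - 36*δ + 10) ≤
      sInf ((fun θ : ℝ => (b θ / a θ).re) '' Set.Ico (0:ℝ) (2*π)) ∧
    (24*δ^2 - 21*δ + 3) / (36*δ^2 - 18*δ + 3) ≤
      sInf ((fun θ : ℝ => (b θ / a θ).re) '' Set.Ico (0:ℝ) (2*π)) /
        sSup ((fun θ : ℝ => ‖c θ / a θ‖) '' Set.Ico (0:ℝ) (2*π)) := by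
  have hz (θ : ℝ) : Complex.normSq (Complex.exp (Complex.I * θ)) = 1 := by
    rw [mul_comm, Complex.normSq_eq_norm_sq, Complex.norm_exp_ofReal_mul_I, one_pow]
  have hre (θ : ℝ) : (Complex.exp (Complex.I * θ)).re = cos θ := by
    rw [mul_comm, Complex.exp_ofReal_mul_I_re]
  have hx (θ : ℝ) : (Complex.exp (Complex.I * θ)).re ≤ 1 := hre θ ▸ cos_le_one θ
  have hx' (θ : ℝ) : -1 ≤ (Complex.exp (Complex.I * θ)).re := hre θ ▸ neg_one_le_cos θ
  have e2 (θ : ℝ) : Complex.exp (2 * Complex.I * θ) = Complex.exp (Complex.I * θ) ^ 2 := by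
    rw [← Complex.exp_nat_mul]; congr 1; push_cast; ring
  have e3 (θ : ℝ) : Complex.exp (3 * Complex.I * θ) = Complex.exp (Complex.I * θ) ^ 3 := by
    rw [← Complex.exp_nat_mul]; congr 1; push_cast; ring
  have ha' (θ : ℝ) : a θ = derivPoly δ (Complex.exp (Complex.I * θ)) := by
    rw [ha, e2, derivPoly]; push_cast; ring
  have hb' (θ : ℝ) : b θ = implicitPoly δ (Complex.exp (Complex.I * θ)) := by
    rw [hb, e2, e3, implicitPoly]; push_cast; ring
  have hc' (θ : ℝ) : c θ = explicitPoly δ (Complex.exp (Complex.I * θ)) := by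
    rw [hc, e2, explicitPoly]; push_cast; ring
  have haSq (θ : ℝ) : 1 ≤ Complex.normSq (a θ) := by
    rw [ha']; exact one_le_normSq_derivPoly hδ (hz θ) (hx θ)
  have haNorm (θ : ℝ) : 1 ≤ ‖a θ‖ := by
    have := haSq θ
    rwa [Complex.normSq_eq_norm_sq, one_le_sq_iff₀ (norm_nonneg _)] at this
  have hD : 0 < 36*δ^2 - 36*δ + 10 := by nlinarith
  have hM : 0 < 36*δ^2 - 18*δ + 3 := by nlinarith
  have h0 : (0 : ℝ) ∈ Ico (0:ℝ) (2*π) := ⟨le_rfl, two_pi_pos⟩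
  have hπ : π ∈ Ico (0:ℝ) (2*π) := ⟨pi_pos.le, by linarith [pi_pos]⟩
  have hexpπ : Complex.exp (Complex.I * π) = -1 := by rw [mul_comm, Complex.exp_pi_mul_I]
  have hexplicit : sSup ((fun θ : ℝ => ‖c θ / a θ‖) '' Ico (0:ℝ) (2*π)) =
      (36*δ^2 - 18*δ + 3) / (36*δ^2 - 36*δ + 10) := by
    refine IsGreatest.csSup_eq ⟨⟨π, hπ, ?_⟩, ?_⟩
    · have hcπ : c π = ((12*δ^2 - 6*δ + 1 : ℝ) : ℂ) := by
        rw [hc', hexpπ, explicitPoly]; push_cast; ring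
      have haπ : a π = (((36*δ^2 - 36*δ + 10) / 3 : ℝ) : ℂ) := by
        rw [ha', hexpπ, derivPoly]; push_cast; ring
      simp only [hcπ, haπ]
      rw [← Complex.ofReal_div, Complex.norm_real, Real.norm_of_nonneg]
      · field_simp
        ring
      · exact div_nonneg (by linarith) (by linarith)
    · rintro _ ⟨θ, -, rfl⟩
      have h := normSq_explicitPoly_le hδ (hz θ) (hx θ) (hx' θ)
      rw [← ha', ← hc', Complex.normSq_eq_norm_sq, Complex.normSq_eq_norm_sq, ← mul_pow,
        ← mul_pow] at h
      have h' := le_of_sq_le_sq h (by positivity)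
      simp only [norm_div]
      rw [div_le_div_iff₀ (by linarith [haNorm θ]) hD]
      linarith
  have himplicit : (24*δ^2 - 21*δ + 3) / (36*δ^2 - 36*δ + 10) ≤
      sInf ((fun θ : ℝ => (b θ / a θ).re) '' Ico (0:ℝ) (2*π)) := by
    refine le_csInf ⟨_, 0, h0, rfl⟩ ?_
    rintro _ ⟨θ, -, rfl⟩
    have h := dissipation_bound hδ (hz θ) (hx θ)
    rw [← ha', ← hb'] at h
    have hdiv : (b θ / a θ).re =
        (b θ * (starRingEnd ℂ) (a θ)).re / Complex.normSq (a θ) := by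
      simp [Complex.div_re, Complex.mul_re, add_div]
    simp only [hdiv]
    rw [div_le_div_iff₀ hD (by linarith [haSq θ])]
    linarith
  refine ⟨fun θ _ h => ?_, ?_, hexplicit, himplicit, ?_⟩
  · have := haNorm θ
    rw [h, norm_zero] at this
    linarith
  · refine IsGreatest.csSup_eq ⟨⟨0, h0, ?_⟩, ?_⟩
    · have ha0 : a 0 = 1 := by
        rw [ha', derivPoly]; simp; ring
      simp [ha0]
    · rintro _ ⟨θ, -, rfl⟩
      simpa using inv_le_one_of_one_le₀ (haNorm θ)
  · rw [hexplicit, le_div_iff₀ (div_pos hM hD), div_mul_div_cancel₀ hM.ne']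
    exact himplicit
end

section
/- Fix a real parameter β ≥ 1 and define for θ ∈ [0,2π) the trigonometric polynomials a(θ) = (3β² + 6β + 2)/6 − ((6β² + 6β − 5)/6)e^{iθ} + ((3β² − 1)/6)e^{2iθ}, b(θ) = (β² + β)/2 + (1 − β²)e^{iθ} + ((β² − β)/2)e^{2iθ} and c(θ) = (β² + 3β + 2)/2 − (β² + 2β)e^{iθ} + ((β² + β)/2)e^{2iθ} (the semi-generating functions of the GBDF3 scheme). Then a(θ) ≠ 0 for all θ, and: max_{θ∈[0,2π)} |1/a(θ)| = 1, max_{θ∈[0,2π)} |c(θ)/a(θ)| = (6β² + 12β + 3)/(6β² + 6β − 2), and (6β² − 4)/(6β² + 6β − 2) ≤ min_{θ∈[0,2π)} Re(b(θ)/a(θ)) ≤ (6β² − 3)/(6β² + 6β − 2). Consequently the implicit–explicit controllability intensity lies between (6β² − 4)/(6β² + 12β + 3) and (6β² − 3)/(6β² + 12β + 3). -/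
open Real Set

/-- The trigonometric polynomial `p + q e^{iθ} + r e^{2iθ}` with real coefficients. -/
noncomputable def trigQuadratic (p q r θ : ℝ) : ℂ :=
  p + q * Complex.exp (Complex.I * θ) + r * Complex.exp (2 * Complex.I * θ)

lemma trigQuadratic_re (p q r θ : ℝ) :
    (trigQuadratic p q r θ).re = p + q * cos θ + r * (2 * cos θ ^ 2 - 1) := by
  have h : (2 * Complex.I * θ : ℂ) = ((2 * θ : ℝ) : ℂ) * Complex.I := by push_cast; ring
  rw [trigQuadratic, h, mul_comm Complex.I]
  simp only [Complex.add_re, Complex.re_ofReal_mul, Complex.exp_ofReal_mul_I_re,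
    Complex.ofReal_re, cos_two_mul]

lemma trigQuadratic_im (p q r θ : ℝ) :
    (trigQuadratic p q r θ).im = q * sin θ + r * (2 * sin θ * cos θ) := by
  have h : (2 * Complex.I * θ : ℂ) = ((2 * θ : ℝ) : ℂ) * Complex.I := by push_cast; ring
  rw [trigQuadratic, h, mul_comm Complex.I]
  simp only [Complex.add_im, Complex.im_ofReal_mul, Complex.exp_ofReal_mul_I_im,
    Complex.ofReal_im, sin_two_mul, zero_add]

/-- The real part of `P * conj Q` for two quadratic trigonometric polynomials, in powers of
`1 - cos θ`. -/
lemma trigQuadratic_re_mul_re_add_im_mul_im (p q r p' q' r' θ : ℝ) :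
    (trigQuadratic p q r θ).re * (trigQuadratic p' q' r' θ).re +
        (trigQuadratic p q r θ).im * (trigQuadratic p' q' r' θ).im =
      (p + q + r) * (p' + q' + r') -
        (p * q' + q * p' + q * r' + r * q' + 4 * (p * r' + r * p')) * (1 - cos θ) +
        2 * (p * r' + r * p') * (1 - cos θ) ^ 2 := by
  rw [trigQuadratic_re, trigQuadratic_re, trigQuadratic_im, trigQuadratic_im]
  linear_combination
    (q + 2 * r * cos θ) * (q' + 2 * r' * cos θ) * sin_sq_add_cos_sq θ

lemma normSq_trigQuadratic (p q r θ : ℝ) :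
    Complex.normSq (trigQuadratic p q r θ) =
      (p + q + r) ^ 2 - (2 * q * (p + r) + 8 * p * r) * (1 - cos θ) +
        4 * p * r * (1 - cos θ) ^ 2 := by
  rw [Complex.normSq_apply, trigQuadratic_re_mul_re_add_im_mul_im]
  ring

/-- `Re (w / z) = Re (w * conj z) / |z|²`. -/
lemma Complex.div_re_eq_div_normSq (w z : ℂ) :
    (w / z).re = (w.re * z.re + w.im * z.im) / Complex.normSq z := by
  rw [Complex.div_re, ← add_div]

lemma csSup_image_eq_of_isMaxOn {f : ℝ → ℝ} {s : Set ℝ} {x : ℝ} (hx : x ∈ s)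
    (h : ∀ y ∈ s, f y ≤ f x) : sSup (f '' s) = f x :=
  IsGreatest.csSup_eq ⟨mem_image_of_mem f hx, forall_mem_image.2 h⟩

/-- factors and two-sided bounds on the implicit–explicit
controllability intensity of the β-parameterized GBDF3 scheme, for β ≥ 1. -/
theorem stmt14 (β : ℝ) (hβ : 1 ≤ β) (a b c : ℝ → ℂ)
    (ha : ∀ θ : ℝ, a θ = ((3*(β:ℂ)^2 + 6*(β:ℂ) + 2)/6)
        - ((6*(β:ℂ)^2 + 6*(β:ℂ) - 5)/6) * Complex.exp (Complex.I * θ)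
        + ((3*(β:ℂ)^2 - 1)/6) * Complex.exp (2 * Complex.I * θ))
    (hb : ∀ θ : ℝ, b θ = (((β:ℂ)^2 + (β:ℂ))/2)
        + (1 - (β:ℂ)^2) * Complex.exp (Complex.I * θ)
        + (((β:ℂ)^2 - (β:ℂ))/2) * Complex.exp (2 * Complex.I * θ))
    (hc : ∀ θ : ℝ, c θ = (((β:ℂ)^2 + 3*(β:ℂ) + 2)/2)
        - ((β:ℂ)^2 + 2*(β:ℂ)) * Complex.exp (Complex.I * θ)
        + (((β:ℂ)^2 + (β:ℂ))/2) * Complex.exp (2 * Complex.I * θ)) :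
    (∀ θ ∈ Set.Ico (0:ℝ) (2*π), a θ ≠ 0) ∧
    sSup ((fun θ : ℝ => ‖1 / a θ‖) '' Set.Ico (0:ℝ) (2*π)) = 1 ∧
    sSup ((fun θ : ℝ => ‖c θ / a θ‖) '' Set.Ico (0:ℝ) (2*π)) =
      (6*β^2 + 12*β + 3) / (6*β^2 + 6*β - 2) ∧
    ((6*β^2 - 4) / (6*β^2 + 6*β - 2) ≤
        sInf ((fun θ : ℝ => (b θ / a θ).re) '' Set.Ico (0:ℝ) (2*π)) ∧
      sInf ((fun θ : ℝ => (b θ / a θ).re) '' Set.Ico (0:ℝ) (2*π)) ≤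
        (6*β^2 - 3) / (6*β^2 + 6*β - 2)) ∧
    ((6*β^2 - 4) / (6*β^2 + 12*β + 3) ≤
        sInf ((fun θ : ℝ => (b θ / a θ).re) '' Set.Ico (0:ℝ) (2*π)) /
          sSup ((fun θ : ℝ => ‖c θ / a θ‖) '' Set.Ico (0:ℝ) (2*π)) ∧
      sInf ((fun θ : ℝ => (b θ / a θ).re) '' Set.Ico (0:ℝ) (2*π)) /
          sSup ((fun θ : ℝ => ‖c θ / a θ‖) '' Set.Ico (0:ℝ) (2*π)) ≤
        (6*β^2 - 3) / (6*β^2 + 12*β + 3)) := by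
  have ha' : ∀ θ, a θ = trigQuadratic ((3*β^2 + 6*β + 2)/6) (-((6*β^2 + 6*β - 5)/6))
      ((3*β^2 - 1)/6) θ := by
    intro θ; rw [ha, trigQuadratic]; push_cast; ring
  have hb' : ∀ θ, b θ = trigQuadratic ((β^2 + β)/2) (1 - β^2) ((β^2 - β)/2) θ := by
    intro θ; rw [hb, trigQuadratic]; push_cast; ring
  have hc' : ∀ θ, c θ = trigQuadratic ((β^2 + 3*β + 2)/2) (-(β^2 + 2*β)) ((β^2 + β)/2) θ := by
    intro θ; rw [hc, trigQuadratic]; push_cast; ring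
  obtain ⟨s, hs, rfl⟩ : ∃ s : ℝ, 0 ≤ s ∧ β = 1 + s := ⟨β - 1, by linarith, by ring⟩
  have hD : 0 < 6*(1 + s)^2 + 6*(1 + s) - 2 := by nlinarith
  have hA : ∀ θ, Complex.normSq (a θ) = 1 + (1 - cos θ) / 6 +
      (22 + 90*s + 111*s^2 + 54*s^3 + 9*s^4) / 9 * (1 - cos θ) ^ 2 := by
    intro θ; rw [ha', normSq_trigQuadratic]; ring
  have hC : ∀ θ, Complex.normSq (c θ) =
      1 + (1 + s) * (3 + s) * (2 + s) ^ 2 * (1 - cos θ) ^ 2 := by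
    intro θ; rw [hc', normSq_trigQuadratic]; ring
  have hM : ∀ θ, (b θ).re * (a θ).re + (b θ).im * (a θ).im = 1 - (1 - cos θ) / 6 +
      (4 + 29*s + 49*s^2 + 30*s^3 + 6*s^4) / 6 * (1 - cos θ) ^ 2 := by
    intro θ; rw [ha', hb', trigQuadratic_re_mul_re_add_im_mul_im]; ring
  have ht : ∀ θ, 0 ≤ 1 - cos θ := fun θ => sub_nonneg.2 (cos_le_one θ)
  have ht2 : ∀ θ, 0 ≤ 2 - (1 - cos θ) := fun θ => by linarith [neg_one_le_cos θ]
  have hA1 : ∀ θ, 1 ≤ Complex.normSq (a θ) := by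
    intro θ
    have h₁ := ht θ
    have h₂ : 0 ≤ (22 + 90*s + 111*s^2 + 54*s^3 + 9*s^4) / 9 * (1 - cos θ) ^ 2 := by positivity
    rw [hA]
    linarith
  have hA0 : ∀ θ, 0 < Complex.normSq (a θ) := fun θ => one_pos.trans_le (hA1 θ)
  have hne : ∀ θ, a θ ≠ 0 := fun θ => Complex.normSq_pos.1 (hA0 θ)
  have hratio : ∀ θ, ‖c θ / a θ‖ ^ 2 = Complex.normSq (c θ) / Complex.normSq (a θ) := by
    intro θ; rw [← Complex.normSq_eq_norm_sq, map_div₀]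
  have hmem0 : (0:ℝ) ∈ Ico (0:ℝ) (2*π) := ⟨le_rfl, by positivity⟩
  have hmempi : π ∈ Ico (0:ℝ) (2*π) := ⟨pi_pos.le, by linarith [pi_pos]⟩
  have hsup1 : sSup ((fun θ : ℝ => ‖1 / a θ‖) '' Ico (0:ℝ) (2*π)) = 1 := by
    have h0 : ‖1 / a 0‖ = 1 := by
      have h : a 0 = 1 := by rw [ha]; simp; ring
      simp [h]
    refine (csSup_image_eq_of_isMaxOn hmem0 fun θ _ => ?_).trans h0
    simp only [h0, norm_div, norm_one]
    refine div_le_one_of_le₀ ?_ (norm_nonneg _)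
    rw [← one_le_sq_iff₀ (norm_nonneg _), ← Complex.normSq_eq_norm_sq]
    exact hA1 θ
  have hsup2 : sSup ((fun θ : ℝ => ‖c θ / a θ‖) '' Ico (0:ℝ) (2*π)) =
      (6*(1 + s)^2 + 12*(1 + s) + 3) / (6*(1 + s)^2 + 6*(1 + s) - 2) := by
    have hpi : ‖c π / a π‖ =
        (6*(1 + s)^2 + 12*(1 + s) + 3) / (6*(1 + s)^2 + 6*(1 + s) - 2) := by
      rw [← sq_eq_sq₀ (norm_nonneg _) (by positivity), hratio, div_pow,
        div_eq_div_iff (hA0 π).ne' (by positivity), hA, hC, cos_pi]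
      ring
    refine (csSup_image_eq_of_isMaxOn hmempi fun θ _ => ?_).trans hpi
    simp only [hpi]
    rw [← sq_le_sq₀ (norm_nonneg _) (by positivity), hratio, div_pow,
      div_le_div_iff₀ (hA0 θ) (by positivity), ← sub_nonneg]
    have h : (6*(1 + s)^2 + 12*(1 + s) + 3)^2 * Complex.normSq (a θ) -
        Complex.normSq (c θ) * (6*(1 + s)^2 + 6*(1 + s) - 2)^2 =
        (2 - (1 - cos θ)) * ((12276 + 23328*s + 13824*s^2 + 2592*s^3) / 72 +
          (4392 + 8856*s + 5940*s^2 + 1512*s^3 + 108*s^4) / 36 * (1 - cos θ)) := by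
      rw [hA, hC]; ring
    rw [h]
    have h₁ := ht θ
    exact mul_nonneg (ht2 θ) (by positivity)
  have hlow : ∀ θ, (6*(1 + s)^2 - 4) / (6*(1 + s)^2 + 6*(1 + s) - 2) ≤ (b θ / a θ).re := by
    intro θ
    rw [Complex.div_re_eq_div_normSq, div_le_div_iff₀ hD (hA0 θ), hA, hM, ← sub_nonneg]
    set t := 1 - cos θ
    refine nonneg_of_mul_nonneg_right (a := 144 * (64 + 396*s + 480*s^2 + 216*s^3 + 36*s^4))
      ?_ (by positivity)
    have h : 0 ≤ (2 * (64 + 396*s + 480*s^2 + 216*s^3 + 36*s^4) * t -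
        (72 + 180*s + 72*s^2)) ^ 2 +
        (68544 + 485568*s + 852336*s^2 + 637632*s^3 + 222912*s^4 + 31104*s^5) := by positivity
    linear_combination h
  have hpi : (b π / a π).re = (6*(1 + s)^2 - 3) / (6*(1 + s)^2 + 6*(1 + s) - 2) := by
    rw [Complex.div_re_eq_div_normSq, div_eq_div_iff (hA0 π).ne' hD.ne', hA, hM, cos_pi]
    ring
  have hinf_ge : (6*(1 + s)^2 - 4) / (6*(1 + s)^2 + 6*(1 + s) - 2) ≤
      sInf ((fun θ : ℝ => (b θ / a θ).re) '' Ico (0:ℝ) (2*π)) :=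
    le_csInf ⟨_, mem_image_of_mem _ hmem0⟩ (forall_mem_image.2 fun θ _ => hlow θ)
  have hinf_le : sInf ((fun θ : ℝ => (b θ / a θ).re) '' Ico (0:ℝ) (2*π)) ≤
      (6*(1 + s)^2 - 3) / (6*(1 + s)^2 + 6*(1 + s) - 2) :=
    csInf_le ⟨_, forall_mem_image.2 fun θ _ => hlow θ⟩ ⟨π, hmempi, hpi⟩
  refine ⟨fun θ _ => hne θ, hsup1, hsup2, ⟨hinf_ge, hinf_le⟩, ?_, ?_⟩
  · rw [hsup2, ← div_div_div_cancel_right₀ hD.ne']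
    gcongr
  · rw [hsup2, ← div_div_div_cancel_right₀ hD.ne' (6*(1 + s)^2 - 3)]
    gcongr
end

section
/- Fix a real parameter β and define for θ ∈ [0,2π) the trigonometric polynomials a(θ) = (2β³+9β²+11β+3)/12 + ((−6β³−21β²−9β+13)/12)e^{iθ} + ((6β³+15β²−3β−5)/12)e^{2iθ} + ((−2β³−3β²+β+1)/12)e^{3iθ}, b(θ) = (β³+3β²+2β)/6 + ((−β³−2β²+β+2)/2)e^{iθ} + ((β³+β²−2β)/2)e^{2iθ} + ((β−β³)/6)e^{3iθ} and c(θ) = (β³+6β²+11β+6)/6 + ((−β³−5β²−6β)/2)e^{iθ} + ((β³+4β²+3β)/2)e^{2iθ} + ((−β³−3β²−2β)/6)e^{3iθ} (the semi-generating functions of the GBDF4 scheme). If β ≥ 1 then a(θ) ≠ 0 for all θ and: max_{θ∈[0,2π)} |1/a(θ)| ≥ 1, max_{θ∈[0,2π)} |c(θ)/a(θ)| ≥ (4β³+18β²+20β+3)/(4(β³+3β²+β−1)), and min_{θ∈[0,2π)} Re(b(θ)/a(θ)) ≤ (4β³+6β²−4β−3)/(4(β³+3β²+β−1)), so the implicit–explicit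 controllability intensity is at most (4β³+6β²−4β−3)/(4β³+18β²+20β+3). Moreover, for β = 9: max_θ |1/a(θ)| ≤ 49/45, max_θ |c(θ)/a(θ)| ≤ 2319/1960, min_θ Re(b(θ)/a(θ)) ≥ 1641/1960, and the implicit–explicit controllability intensity is at least 547/773. -/
open Real Set

/-- A cubic in `e^{iθ}` with real coefficients, split into real and imaginary parts. -/
lemma trigCubic_eq (p q r s θ : ℝ) :
    (p : ℂ) + q * Complex.exp (Complex.I * θ) + r * Complex.exp (2 * Complex.I * θ)
        + s * Complex.exp (3 * Complex.I * θ) =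
      ⟨p + q * cos θ + r * (2 * cos θ ^ 2 - 1) + s * (4 * cos θ ^ 3 - 3 * cos θ),
        sin θ * (q + 2 * r * cos θ + s * (4 * cos θ ^ 2 - 1))⟩ := by
  have h1 : Complex.exp (Complex.I * θ) = Complex.cos θ + Complex.sin θ * Complex.I := by
    rw [mul_comm, Complex.exp_mul_I]
  have h2 : Complex.exp (2 * Complex.I * θ) = Complex.exp (Complex.I * θ) ^ 2 := by
    rw [← Complex.exp_nat_mul]; congr 1; push_cast; ring
  have h3 : Complex.exp (3 * Complex.I * θ) = Complex.exp (Complex.I * θ) ^ 3 := by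
    rw [← Complex.exp_nat_mul]; congr 1; push_cast; ring
  have hs := Real.sin_sq_add_cos_sq θ
  rw [h2, h3, h1, ← Complex.ofReal_cos, ← Complex.ofReal_sin]
  generalize cos θ = C at hs ⊢
  generalize sin θ = S at hs ⊢
  apply Complex.ext
  · simp [pow_succ]
    linear_combination (-r - 3 * s * C) * hs
  · simp [pow_succ]
    linear_combination (-s * S) * hs

/-- The cubic in `y = 1 - cos θ` that equals `|a(θ)|²` is at least `3 / 4` for `y ≥ 0` and `β ≥ 1`. -/
lemma three_quarters_le_cubic {β y : ℝ} (hβ : 1 ≤ β) (hy : 0 ≤ y) :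
    3 / 4 ≤ 1 + y / 6 + (-β ^ 4 / 3 - 4 * β ^ 3 / 3 - β ^ 2 + 2 * β / 3 + 4 / 9) * y ^ 2
      + (2 * β ^ 6 / 9 + 4 * β ^ 5 / 3 + 47 * β ^ 4 / 18 + 14 * β ^ 3 / 9 - 11 * β ^ 2 / 18
        - 7 * β / 9 - 1 / 6) * y ^ 3 := by
  obtain ⟨s, hs, rfl⟩ : ∃ s, 0 ≤ s ∧ β = 1 + s := ⟨β - 1, by linarith, by ring⟩
  set w := ((1 + s) ^ 2 + 2 * (1 + s)) * y / 3 with hw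
  have hw0 : 0 ≤ w := by positivity
  have h1 : 0 ≤ (w - 1 / 2) ^ 2 * (4 * w + 1) := by positivity
  have h2 : 0 ≤ (((1 + s) ^ 2 + 2 * (1 + s)) / 3 + 4 / 9) * y ^ 2 := by positivity
  have h3 : 0 ≤ (2 * s ^ 6 / 27 + 8 * s ^ 5 / 9 + 25 * s ^ 4 / 6 + 260 * s ^ 3 / 27
      + 199 * s ^ 2 / 18 + 46 * s / 9 + 1 / 6) * y ^ 3 := by positivity
  have h4 : 0 ≤ y / 6 := by positivity
  rw [hw] at h1
  nlinarith [h1, h2, h3, h4]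

/-- factors and implicit–explicit controllability intensity of
the β-parameterized GBDF4 scheme: bounds for β ≥ 1 and sharper numerical
bounds for β = 9. -/
theorem stmt15 (β : ℝ) (a b c : ℝ → ℂ)
    (ha : ∀ θ : ℝ, a θ = ((2*(β:ℂ)^3 + 9*(β:ℂ)^2 + 11*(β:ℂ) + 3)/12)
        + ((-6*(β:ℂ)^3 - 21*(β:ℂ)^2 - 9*(β:ℂ) + 13)/12) * Complex.exp (Complex.I * θ)
        + ((6*(β:ℂ)^3 + 15*(β:ℂ)^2 - 3*(β:ℂ) - 5)/12) * Complex.exp (2 * Complex.I * θ)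
        + ((-2*(β:ℂ)^3 - 3*(β:ℂ)^2 + (β:ℂ) + 1)/12) * Complex.exp (3 * Complex.I * θ))
    (hb : ∀ θ : ℝ, b θ = (((β:ℂ)^3 + 3*(β:ℂ)^2 + 2*(β:ℂ))/6)
        + ((-(β:ℂ)^3 - 2*(β:ℂ)^2 + (β:ℂ) + 2)/2) * Complex.exp (Complex.I * θ)
        + (((β:ℂ)^3 + (β:ℂ)^2 - 2*(β:ℂ))/2) * Complex.exp (2 * Complex.I * θ)
        + (((β:ℂ) - (β:ℂ)^3)/6) * Complex.exp (3 * Complex.I * θ))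
    (hc : ∀ θ : ℝ, c θ = (((β:ℂ)^3 + 6*(β:ℂ)^2 + 11*(β:ℂ) + 6)/6)
        + ((-(β:ℂ)^3 - 5*(β:ℂ)^2 - 6*(β:ℂ))/2) * Complex.exp (Complex.I * θ)
        + (((β:ℂ)^3 + 4*(β:ℂ)^2 + 3*(β:ℂ))/2) * Complex.exp (2 * Complex.I * θ)
        + ((-(β:ℂ)^3 - 3*(β:ℂ)^2 - 2*(β:ℂ))/6) * Complex.exp (3 * Complex.I * θ)) :
    (1 ≤ β →
      (∀ θ ∈ Set.Ico (0:ℝ) (2*π), a θ ≠ 0) ∧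
      1 ≤ sSup ((fun θ : ℝ => ‖1 / a θ‖) '' Set.Ico (0:ℝ) (2*π)) ∧
      (4*β^3 + 18*β^2 + 20*β + 3) / (4*(β^3 + 3*β^2 + β - 1)) ≤
        sSup ((fun θ : ℝ => ‖c θ / a θ‖) '' Set.Ico (0:ℝ) (2*π)) ∧
      sInf ((fun θ : ℝ => (b θ / a θ).re) '' Set.Ico (0:ℝ) (2*π)) ≤
        (4*β^3 + 6*β^2 - 4*β - 3) / (4*(β^3 + 3*β^2 + β - 1)) ∧
      sInf ((fun θ : ℝ => (b θ / a θ).re) '' Set.Ico (0:ℝ) (2*π)) /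
          sSup ((fun θ : ℝ => ‖c θ / a θ‖) '' Set.Ico (0:ℝ) (2*π)) ≤
        (4*β^3 + 6*β^2 - 4*β - 3) / (4*β^3 + 18*β^2 + 20*β + 3)) ∧
    (β = 9 →
      sSup ((fun θ : ℝ => ‖1 / a θ‖) '' Set.Ico (0:ℝ) (2*π)) ≤ 49/45 ∧
      sSup ((fun θ : ℝ => ‖c θ / a θ‖) '' Set.Ico (0:ℝ) (2*π)) ≤ 2319/1960 ∧
      1641/1960 ≤ sInf ((fun θ : ℝ => (b θ / a θ).re) '' Set.Ico (0:ℝ) (2*π)) ∧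
      547/773 ≤ sInf ((fun θ : ℝ => (b θ / a θ).re) '' Set.Ico (0:ℝ) (2*π)) /
          sSup ((fun θ : ℝ => ‖c θ / a θ‖) '' Set.Ico (0:ℝ) (2*π))) := by
  have hπ : (0 : ℝ) < 2 * π := by positivity
  have haq (θ : ℝ) := trigCubic_eq ((2*β^3 + 9*β^2 + 11*β + 3)/12) ((-6*β^3 - 21*β^2 - 9*β + 13)/12)
      ((6*β^3 + 15*β^2 - 3*β - 5)/12) ((-2*β^3 - 3*β^2 + β + 1)/12) θ
  push_cast at haq
  simp only [← ha] at haq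
  have hbq (θ : ℝ) := trigCubic_eq ((β^3 + 3*β^2 + 2*β)/6) ((-β^3 - 2*β^2 + β + 2)/2)
      ((β^3 + β^2 - 2*β)/2) ((β - β^3)/6) θ
  push_cast at hbq
  simp only [← hb] at hbq
  have hcq (θ : ℝ) := trigCubic_eq ((β^3 + 6*β^2 + 11*β + 6)/6) ((-β^3 - 5*β^2 - 6*β)/2)
      ((β^3 + 4*β^2 + 3*β)/2) ((-β^3 - 3*β^2 - 2*β)/6) θ
  push_cast at hcq
  simp only [← hc] at hcq
  have hna (θ : ℝ) : Complex.normSq (a θ) = 1 + (1 - cos θ) / 6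
      + (-β ^ 4 / 3 - 4 * β ^ 3 / 3 - β ^ 2 + 2 * β / 3 + 4 / 9) * (1 - cos θ) ^ 2
      + (2 * β ^ 6 / 9 + 4 * β ^ 5 / 3 + 47 * β ^ 4 / 18 + 14 * β ^ 3 / 9 - 11 * β ^ 2 / 18
        - 7 * β / 9 - 1 / 6) * (1 - cos θ) ^ 3 := by
    rw [haq, Complex.normSq_mk, mul_mul_mul_comm, ← sq (sin θ), sin_sq]
    ring
  have hnc (θ : ℝ) : Complex.normSq (c θ) = 1
      + (-β ^ 4 / 3 - 2 * β ^ 3 - 11 * β ^ 2 / 3 - 2 * β) * (1 - cos θ) ^ 2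
      + (2 * β ^ 6 / 9 + 2 * β ^ 5 + 62 * β ^ 4 / 9 + 34 * β ^ 3 / 3 + 80 * β ^ 2 / 9
        + 8 * β / 3) * (1 - cos θ) ^ 3 := by
    rw [hcq, Complex.normSq_mk, mul_mul_mul_comm, ← sq (sin θ), sin_sq]
    ring
  have hba (θ : ℝ) : (b θ).re * (a θ).re + (b θ).im * (a θ).im = 1 - (1 - cos θ) / 6
      + (-β ^ 4 / 3 - β ^ 3 - β ^ 2 / 3 + 2 * β / 3 + 1 / 6) * (1 - cos θ) ^ 2
      + (2 * β ^ 6 / 9 + β ^ 5 + 7 * β ^ 4 / 6 - 2 * β ^ 3 / 9 - 8 * β ^ 2 / 9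
        - 5 * β / 18) * (1 - cos θ) ^ 3 := by
    rw [haq, hbq, mul_mul_mul_comm, ← sq (sin θ), sin_sq]
    ring
  have ha0 (h : 1 ≤ β) (θ : ℝ) : 0 < Complex.normSq (a θ) := by
    rw [hna]
    linarith [three_quarters_le_cubic h (y := 1 - cos θ) (by linarith [cos_le_one θ])]
  have hane (h : 1 ≤ β) (θ : ℝ) : a θ ≠ 0 := Complex.normSq_pos.1 (ha0 h θ)
  have hac : Continuous a := by rw [funext ha]; fun_prop
  have hbc : Continuous b := by rw [funext hb]; fun_prop
  have hcc : Continuous c := by rw [funext hc]; fun_prop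
  have hbdd {f : ℝ → ℝ} (hf : Continuous f) : BddAbove (f '' Ico 0 (2 * π)) ∧
      BddBelow (f '' Ico 0 (2 * π)) :=
    ⟨(isCompact_Icc.bddAbove_image hf.continuousOn).mono (image_mono Ico_subset_Icc_self),
      (isCompact_Icc.bddBelow_image hf.continuousOn).mono (image_mono Ico_subset_Icc_self)⟩
  have h0mem : (0 : ℝ) ∈ Ico 0 (2 * π) := ⟨le_rfl, hπ⟩
  have hπmem : π ∈ Ico 0 (2 * π) := ⟨pi_pos.le, by linarith [pi_pos]⟩
  have haπ : a π = ((4 * (β^3 + 3*β^2 + β - 1) / 3 : ℝ) : ℂ) := by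
    rw [haq, cos_pi, sin_pi]
    apply Complex.ext <;> simp only [Complex.ofReal_re, Complex.ofReal_im] <;> ring
  have hbπ : b π = (((4*β^3 + 6*β^2 - 4*β - 3) / 3 : ℝ) : ℂ) := by
    rw [hbq, cos_pi, sin_pi]
    apply Complex.ext <;> simp only [Complex.ofReal_re, Complex.ofReal_im] <;> ring
  have hcπ : c π = (((4*β^3 + 18*β^2 + 20*β + 3) / 3 : ℝ) : ℂ) := by
    rw [hcq, cos_pi, sin_pi]
    apply Complex.ext <;> simp only [Complex.ofReal_re, Complex.ofReal_im] <;> ring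
  have hE (h : 1 ≤ β) : (4*β^3 + 18*β^2 + 20*β + 3) / (4*(β^3 + 3*β^2 + β - 1)) ≤
      sSup ((fun θ : ℝ => ‖c θ / a θ‖) '' Ico (0:ℝ) (2*π)) := by
    refine le_csSup (hbdd (hcc.div hac (hane h)).norm).1 ⟨π, hπmem, ?_⟩
    have h3 : 1 ≤ β ^ 3 := one_le_pow₀ h
    have h2 : 1 ≤ β ^ 2 := one_le_pow₀ h
    simp only
    rw [haπ, hcπ, ← Complex.ofReal_div, Complex.norm_real, Real.norm_of_nonneg,
      div_div_div_cancel_right₀ three_ne_zero]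
    apply div_nonneg <;> linarith
  have hI (h : 1 ≤ β) : sInf ((fun θ : ℝ => (b θ / a θ).re) '' Ico (0:ℝ) (2*π)) ≤
      (4*β^3 + 6*β^2 - 4*β - 3) / (4*(β^3 + 3*β^2 + β - 1)) := by
    refine csInf_le (hbdd (Complex.continuous_re.comp (hbc.div hac (hane h)))).2
      ⟨π, hπmem, ?_⟩
    simp only
    rw [haπ, hbπ, ← Complex.ofReal_div, Complex.ofReal_re,
      div_div_div_cancel_right₀ three_ne_zero]
  refine ⟨fun h => ⟨fun θ _ => hane h θ, ?_, hE h, hI h, ?_⟩, ?_⟩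
  · refine le_csSup (hbdd (continuous_const.div hac (hane h)).norm).1 ⟨0, h0mem, ?_⟩
    have : a 0 = 1 := by
      rw [haq]; apply Complex.ext <;> simp
      ring
    simp [this]
  · have h3 : β ^ 2 ≤ β ^ 3 := pow_le_pow_right₀ h (by norm_num)
    have h2 : β ≤ β ^ 2 := le_self_pow₀ h two_ne_zero
    have hD : 0 < 4 * (β^3 + 3*β^2 + β - 1) := by linarith
    refine (div_le_div₀ (div_nonneg (by linarith) hD.le) (hI h) (div_pos (by linarith) hD)
      (hE h)).trans_eq ?_
    rw [div_div_div_cancel_right₀ hD.ne']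
  · rintro rfl
    have h1 : (1 : ℝ) ≤ 9 := by norm_num
    have hy (θ : ℝ) : 0 ≤ 1 - cos θ := by linarith [cos_le_one θ]
    have hEp := (by norm_num : (0 : ℝ) < _).trans_le (hE h1)
    have hE' : sSup ((fun θ : ℝ => ‖c θ / a θ‖) '' Ico (0:ℝ) (2*π)) ≤ 2319/1960 := by
      refine csSup_le ⟨_, 0, h0mem, rfl⟩ ?_
      rintro _ ⟨θ, -, rfl⟩
      simp only
      rw [norm_div, div_le_iff₀ (norm_pos_iff.2 (hane h1 θ))]
      refine (sq_le_sq₀ (by positivity) (by positivity)).1 ?_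
      rw [mul_pow, ← Complex.normSq_eq_norm_sq, ← Complex.normSq_eq_norm_sq, hna, hnc]
      nlinarith [hy θ, mul_nonneg (sq_nonneg (1 - cos θ - 1 / 28))
        (by linarith [hy θ] : 0 ≤ 1 - cos θ + 1 / 56), sq_nonneg (1 - cos θ)]
    have hI' : 1641/1960 ≤ sInf ((fun θ : ℝ => (b θ / a θ).re) '' Ico (0:ℝ) (2*π)) := by
      refine le_csInf ⟨_, 0, h0mem, rfl⟩ ?_
      rintro _ ⟨θ, -, rfl⟩
      simp only
      rw [Complex.div_re, ← add_div, le_div_iff₀ (ha0 h1 θ), hba, hna]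
      nlinarith [hy θ, mul_nonneg (sq_nonneg (1 - cos θ - 1 / 29))
        (by linarith [hy θ] : 0 ≤ 1 - cos θ + 1 / 58), sq_nonneg (1 - cos θ - 1 / 29)]
    refine ⟨?_, hE', hI', ?_⟩
    · refine csSup_le ⟨_, 0, h0mem, rfl⟩ ?_
      rintro _ ⟨θ, -, rfl⟩
      simp only
      rw [norm_div, norm_one, div_le_iff₀ (norm_pos_iff.2 (hane h1 θ))]
      refine (sq_le_sq₀ (by positivity) (by positivity)).1 ?_
      rw [mul_pow, ← Complex.normSq_eq_norm_sq, hna]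
      nlinarith [hy θ, mul_nonneg (sq_nonneg (1 - cos θ - 1 / 99))
        (by linarith [hy θ] : 0 ≤ 1 - cos θ + 1 / 198), sq_nonneg (1 - cos θ)]
    · rw [le_div_iff₀ hEp]
      linarith
end

section
/- Fix a real parameter β and define for θ ∈ [0,2π) the trigonometric polynomials a(θ) = ∑_{j=0}^4 a_j e^{ijθ}, b(θ) = ∑_{j=0}^4 b_j e^{ijθ} and c(θ) = ∑_{j=0}^4 c_j e^{ijθ} with the GBDF5 coefficients a = ((5β⁴+40β³+105β²+100β+24)/120, (−10β⁴−70β³−135β²−25β+77)/60, (15β⁴+90β³+120β²−45β−43)/60, (−10β⁴−50β³−45β²+25β+17)/60, (5β⁴+20β³+15β²−10β−6)/120), b = (β(β³+6β²+11β+6)/24, (−β⁴−5β³−5β²+5β+6)/6, β(β³+4β²+β−6)/4, β(−β³−3β²+β+3)/6, β(β³+2β²−β−2)/24), c = ((β⁴+10β³+35β²+50β+24)/24, −β(β³+9β²+26β+24)/6, β(β³+8β²+19β+12)/4, −β(β³+7β²+14β+8)/6, β(β³+6β²+11β+6)/24). If β ≥ 1 then a(θ) ≠ 0 for all θ and: max_{θ∈[0,2π)}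 |1/a(θ)| ≥ 1, max_{θ∈[0,2π)} |c(θ)/a(θ)| ≥ 5(2β⁴+16β³+40β²+32β+3)/(10β⁴+60β³+90β²−32), and min_{θ∈[0,2π)} Re(b(θ)/a(θ)) ≤ 5(2β⁴+8β³+4β²−8β−3)/(10β⁴+60β³+90β²−32), so the implicit–explicit controllability intensity is at most (2β⁴+8β³+4β²−8β−3)/(2β⁴+16β³+40β²+32β+3). Moreover, for β = 20: max_θ |1/a(θ)| ≤ 399/200, max_θ |c(θ)/a(θ)| ≤ 2501825/2115968, min_θ Re(b(θ)/a(θ)) ≥ 1769085/2115968, and the implicit–explicit controllability intensity is at least 353817/500365. -/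
open Real Set

/-- The real part of a quartic trigonometric polynomial with real coefficients. -/
lemma re_trigPoly (p₀ p₁ p₂ p₃ p₄ θ : ℝ) :
    ((p₀ : ℂ) + p₁ * Complex.exp (Complex.I * θ) + p₂ * Complex.exp (2 * Complex.I * θ)
      + p₃ * Complex.exp (3 * Complex.I * θ) + p₄ * Complex.exp (4 * Complex.I * θ)).re =
    p₀ + p₁ * cos θ + p₂ * (2 * cos θ ^ 2 - 1) + p₃ * (4 * cos θ ^ 3 - 3 * cos θ)
      + p₄ * (8 * cos θ ^ 4 - 8 * cos θ ^ 2 + 1) := by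
  have h4 : cos (4 * θ) = 8 * cos θ ^ 4 - 8 * cos θ ^ 2 + 1 := by
    rw [show 4 * θ = 2 * (2 * θ) by ring, cos_two_mul, cos_two_mul]; ring
  rw [← h4, ← cos_two_mul, ← cos_three_mul]
  simp [Complex.exp_re, Complex.exp_im]

/-- The imaginary part of a quartic trigonometric polynomial with real coefficients. -/
lemma im_trigPoly (p₀ p₁ p₂ p₃ p₄ θ : ℝ) :
    ((p₀ : ℂ) + p₁ * Complex.exp (Complex.I * θ) + p₂ * Complex.exp (2 * Complex.I * θ)
      + p₃ * Complex.exp (3 * Complex.I * θ) + p₄ * Complex.exp (4 * Complex.I * θ)).im =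
    sin θ * (p₁ + p₂ * (2 * cos θ) + p₃ * (4 * cos θ ^ 2 - 1)
      + p₄ * (8 * cos θ ^ 3 - 4 * cos θ)) := by
  have hs := sin_sq_add_cos_sq θ
  have h4 : sin (4 * θ) = sin θ * (8 * cos θ ^ 3 - 4 * cos θ) := by
    rw [show 4 * θ = 2 * (2 * θ) by ring, sin_two_mul, sin_two_mul, cos_two_mul]; ring
  have h3 : sin (3 * θ) = sin θ * (4 * cos θ ^ 2 - 1) := by
    rw [sin_three_mul]; linear_combination (-4 * sin θ) * hs
  simp [Complex.exp_re, Complex.exp_im, h3, h4, sin_two_mul]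
  ring

/-- A discriminant-type criterion for `R - P x³ + Q x⁴` to be positive on the real line. -/
lemma quartic_pos {P Q R : ℝ} (hQ : 0 < Q) (h : 27 * P ^ 4 < 256 * Q ^ 3 * R) (x : ℝ) :
    0 < R - P * x ^ 3 + Q * x ^ 4 := by
  have h1 : 0 ≤ (4 * Q * x - 3 * P) ^ 2 * ((4 * Q * x + P) ^ 2 + 2 * P ^ 2) := by positivity
  have h2 : 0 < 256 * Q ^ 3 * (R - P * x ^ 3 + Q * x ^ 4) := by linarith
  exact pos_of_mul_pos_right h2 (by positivity)

/-- The coefficient of `-x³` in `‖a‖²`, where `x = 1 - cos θ`. -/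
noncomputable def cubicCoeff (β : ℝ) : ℝ :=
  β ^ 6 / 9 + β ^ 5 + 28 / 9 * β ^ 4 + 11 / 3 * β ^ 3 + 17 / 45 * β ^ 2 - 28 / 15 * β - 7 / 10

/-- The coefficient of `x⁴` in `‖a‖²`, where `x = 1 - cos θ`. -/
noncomputable def quarticCoeff (β : ℝ) : ℝ :=
  β ^ 8 / 36 + β ^ 7 / 3 + 14 / 9 * β ^ 6 + 7 / 2 * β ^ 5 + 653 / 180 * β ^ 4 + 23 / 30 * β ^ 3
    - 127 / 90 * β ^ 2 - 14 / 15 * β - 4 / 25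

lemma quarticCoeff_pos {β : ℝ} (hβ : 1 ≤ β) : 0 < quarticCoeff β := by
  obtain ⟨t, ht, rfl⟩ : ∃ t : ℝ, 0 ≤ t ∧ β = 1 + t := ⟨β - 1, by linarith, by ring⟩
  unfold quarticCoeff
  ring_nf
  positivity

lemma cubicCoeff_lt {β : ℝ} (hβ : 1 ≤ β) :
    27 * cubicCoeff β ^ 4 < 256 * quarticCoeff β ^ 3 * 1 := by
  obtain ⟨t, ht, rfl⟩ : ∃ t : ℝ, 0 ≤ t ∧ β = 1 + t := ⟨β - 1, by linarith, by ring⟩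
  rw [← sub_pos]
  unfold quarticCoeff cubicCoeff
  ring_nf
  positivity

/-- factors and implicit–explicit controllability intensity of
the β-parameterized GBDF5 scheme: bounds for β ≥ 1 and sharper numerical
bounds for β = 20. -/
theorem stmt16 (β : ℝ) (a b c : ℝ → ℂ)
    (ha : ∀ θ : ℝ, a θ = ((5*(β:ℂ)^4 + 40*(β:ℂ)^3 + 105*(β:ℂ)^2 + 100*(β:ℂ) + 24)/120)
        + ((-10*(β:ℂ)^4 - 70*(β:ℂ)^3 - 135*(β:ℂ)^2 - 25*(β:ℂ) + 77)/60)
            * Complex.exp (Complex.I * θ)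
        + ((15*(β:ℂ)^4 + 90*(β:ℂ)^3 + 120*(β:ℂ)^2 - 45*(β:ℂ) - 43)/60)
            * Complex.exp (2 * Complex.I * θ)
        + ((-10*(β:ℂ)^4 - 50*(β:ℂ)^3 - 45*(β:ℂ)^2 + 25*(β:ℂ) + 17)/60)
            * Complex.exp (3 * Complex.I * θ)
        + ((5*(β:ℂ)^4 + 20*(β:ℂ)^3 + 15*(β:ℂ)^2 - 10*(β:ℂ) - 6)/120)
            * Complex.exp (4 * Complex.I * θ))
    (hb : ∀ θ : ℝ, b θ = ((β:ℂ)*((β:ℂ)^3 + 6*(β:ℂ)^2 + 11*(β:ℂ) + 6)/24)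
        + ((-(β:ℂ)^4 - 5*(β:ℂ)^3 - 5*(β:ℂ)^2 + 5*(β:ℂ) + 6)/6)
            * Complex.exp (Complex.I * θ)
        + ((β:ℂ)*((β:ℂ)^3 + 4*(β:ℂ)^2 + (β:ℂ) - 6)/4)
            * Complex.exp (2 * Complex.I * θ)
        + ((β:ℂ)*(-(β:ℂ)^3 - 3*(β:ℂ)^2 + (β:ℂ) + 3)/6)
            * Complex.exp (3 * Complex.I * θ)
        + ((β:ℂ)*((β:ℂ)^3 + 2*(β:ℂ)^2 - (β:ℂ) - 2)/24)
            * Complex.exp (4 * Complex.I * θ))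
    (hc : ∀ θ : ℝ, c θ = (((β:ℂ)^4 + 10*(β:ℂ)^3 + 35*(β:ℂ)^2 + 50*(β:ℂ) + 24)/24)
        - ((β:ℂ)*((β:ℂ)^3 + 9*(β:ℂ)^2 + 26*(β:ℂ) + 24)/6)
            * Complex.exp (Complex.I * θ)
        + ((β:ℂ)*((β:ℂ)^3 + 8*(β:ℂ)^2 + 19*(β:ℂ) + 12)/4)
            * Complex.exp (2 * Complex.I * θ)
        - ((β:ℂ)*((β:ℂ)^3 + 7*(β:ℂ)^2 + 14*(β:ℂ) + 8)/6)
            * Complex.exp (3 * Complex.I * θ)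
        + ((β:ℂ)*((β:ℂ)^3 + 6*(β:ℂ)^2 + 11*(β:ℂ) + 6)/24)
            * Complex.exp (4 * Complex.I * θ)) :
    (1 ≤ β →
      (∀ θ ∈ Set.Ico (0:ℝ) (2*π), a θ ≠ 0) ∧
      1 ≤ sSup ((fun θ : ℝ => ‖1 / a θ‖) '' Set.Ico (0:ℝ) (2*π)) ∧
      5*(2*β^4 + 16*β^3 + 40*β^2 + 32*β + 3) / (10*β^4 + 60*β^3 + 90*β^2 - 32) ≤
        sSup ((fun θ : ℝ => ‖c θ / a θ‖) '' Set.Ico (0:ℝ) (2*π)) ∧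
      sInf ((fun θ : ℝ => (b θ / a θ).re) '' Set.Ico (0:ℝ) (2*π)) ≤
        5*(2*β^4 + 8*β^3 + 4*β^2 - 8*β - 3) / (10*β^4 + 60*β^3 + 90*β^2 - 32) ∧
      sInf ((fun θ : ℝ => (b θ / a θ).re) '' Set.Ico (0:ℝ) (2*π)) /
          sSup ((fun θ : ℝ => ‖c θ / a θ‖) '' Set.Ico (0:ℝ) (2*π)) ≤
        (2*β^4 + 8*β^3 + 4*β^2 - 8*β - 3) / (2*β^4 + 16*β^3 + 40*β^2 + 32*β + 3)) ∧
    (β = 20 →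
      sSup ((fun θ : ℝ => ‖1 / a θ‖) '' Set.Ico (0:ℝ) (2*π)) ≤ 399/200 ∧
      sSup ((fun θ : ℝ => ‖c θ / a θ‖) '' Set.Ico (0:ℝ) (2*π)) ≤ 2501825/2115968 ∧
      1769085/2115968 ≤ sInf ((fun θ : ℝ => (b θ / a θ).re) '' Set.Ico (0:ℝ) (2*π)) ∧
      353817/500365 ≤ sInf ((fun θ : ℝ => (b θ / a θ).re) '' Set.Ico (0:ℝ) (2*π)) /
          sSup ((fun θ : ℝ => ‖c θ / a θ‖) '' Set.Ico (0:ℝ) (2*π))) := by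
  have a_re := fun θ : ℝ => re_trigPoly
      ((5*β^4 + 40*β^3 + 105*β^2 + 100*β + 24)/120)
      ((-10*β^4 - 70*β^3 - 135*β^2 - 25*β + 77)/60)
      ((15*β^4 + 90*β^3 + 120*β^2 - 45*β - 43)/60)
      ((-10*β^4 - 50*β^3 - 45*β^2 + 25*β + 17)/60)
      ((5*β^4 + 20*β^3 + 15*β^2 - 10*β - 6)/120) θ
  have a_im := fun θ : ℝ => im_trigPoly
      ((5*β^4 + 40*β^3 + 105*β^2 + 100*β + 24)/120)
      ((-10*β^4 - 70*β^3 - 135*β^2 - 25*β + 77)/60)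
      ((15*β^4 + 90*β^3 + 120*β^2 - 45*β - 43)/60)
      ((-10*β^4 - 50*β^3 - 45*β^2 + 25*β + 17)/60)
      ((5*β^4 + 20*β^3 + 15*β^2 - 10*β - 6)/120) θ
  push_cast at a_re a_im
  simp only [← ha] at a_re a_im
  have b_re := fun θ : ℝ => re_trigPoly
      (β*(β^3 + 6*β^2 + 11*β + 6)/24)
      ((-β^4 - 5*β^3 - 5*β^2 + 5*β + 6)/6)
      (β*(β^3 + 4*β^2 + β - 6)/4)
      (β*(-β^3 - 3*β^2 + β + 3)/6)
      (β*(β^3 + 2*β^2 - β - 2)/24) θ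
  have b_im := fun θ : ℝ => im_trigPoly
      (β*(β^3 + 6*β^2 + 11*β + 6)/24)
      ((-β^4 - 5*β^3 - 5*β^2 + 5*β + 6)/6)
      (β*(β^3 + 4*β^2 + β - 6)/4)
      (β*(-β^3 - 3*β^2 + β + 3)/6)
      (β*(β^3 + 2*β^2 - β - 2)/24) θ
  push_cast at b_re b_im
  simp only [← hb] at b_re b_im
  have c_re := fun θ : ℝ => re_trigPoly
      ((β^4 + 10*β^3 + 35*β^2 + 50*β + 24)/24)
      (-(β*(β^3 + 9*β^2 + 26*β + 24)/6))
      (β*(β^3 + 8*β^2 + 19*β + 12)/4)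
      (-(β*(β^3 + 7*β^2 + 14*β + 8)/6))
      (β*(β^3 + 6*β^2 + 11*β + 6)/24) θ
  have c_im := fun θ : ℝ => im_trigPoly
      ((β^4 + 10*β^3 + 35*β^2 + 50*β + 24)/24)
      (-(β*(β^3 + 9*β^2 + 26*β + 24)/6))
      (β*(β^3 + 8*β^2 + 19*β + 12)/4)
      (-(β*(β^3 + 7*β^2 + 14*β + 8)/6))
      (β*(β^3 + 6*β^2 + 11*β + 6)/24) θ
  push_cast at c_re c_im
  simp only [neg_mul, ← sub_eq_add_neg] at c_re c_im
  simp only [← hc] at c_re c_im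
  have norm_a : ∀ θ, ‖a θ‖ ^ 2 = 1 + (1 - cos θ) / 6 + 2 / 45 * (1 - cos θ) ^ 2
      - cubicCoeff β * (1 - cos θ) ^ 3 + quarticCoeff β * (1 - cos θ) ^ 4 := by
    intro θ
    rw [← Complex.normSq_eq_norm_sq, Complex.normSq_apply, a_re, a_im, cubicCoeff, quarticCoeff,
      mul_mul_mul_comm (sin θ), ← sq (sin θ), sin_sq]
    ring
  have hx : ∀ θ, 0 ≤ 1 - cos θ := fun θ => sub_nonneg.2 (cos_le_one θ)
  have a_ne : 1 ≤ β → ∀ θ, a θ ≠ 0 := by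
    intro hβ θ h0
    have h := norm_a θ
    have hq := quartic_pos (quarticCoeff_pos hβ) (cubicCoeff_lt hβ) (1 - cos θ)
    have := hx θ
    rw [h0, norm_zero] at h
    nlinarith [sq_nonneg (1 - cos θ)]
  have a_cont : Continuous a := by rw [funext ha]; fun_prop
  have b_cont : Continuous b := by rw [funext hb]; fun_prop
  have c_cont : Continuous c := by rw [funext hc]; fun_prop
  have hbdd : ∀ f : ℝ → ℝ, Continuous f →
      BddAbove (f '' Ico (0 : ℝ) (2 * π)) ∧ BddBelow (f '' Ico (0 : ℝ) (2 * π)) := fun f hf =>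
    have hK := isCompact_Icc (a := (0 : ℝ)) (b := 2 * π) |>.image hf
    ⟨hK.bddAbove.mono (image_mono Ico_subset_Icc_self),
      hK.bddBelow.mono (image_mono Ico_subset_Icc_self)⟩
  have h0 : (0 : ℝ) ∈ Ico (0 : ℝ) (2 * π) := ⟨le_rfl, by positivity⟩
  have hπ : π ∈ Ico (0 : ℝ) (2 * π) := ⟨pi_pos.le, by linarith [pi_pos]⟩
  have a_zero : a 0 = 1 := by
    apply Complex.ext
    · rw [a_re, cos_zero, Complex.one_re]; ring
    · rw [a_im, sin_zero, Complex.one_im]; ring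
  have c_zero : c 0 = 1 := by
    apply Complex.ext
    · rw [c_re, cos_zero, Complex.one_re]; ring
    · rw [c_im, sin_zero, Complex.one_im]; ring
  have a_pi : a π = ((10*β^4 + 60*β^3 + 90*β^2 - 32) / 15 : ℝ) := by
    apply Complex.ext
    · rw [a_re, cos_pi, Complex.ofReal_re]; ring
    · rw [a_im, sin_pi, Complex.ofReal_im]; ring
  have b_pi : b π = ((2*β^4 + 8*β^3 + 4*β^2 - 8*β - 3) / 3 : ℝ) := by
    apply Complex.ext
    · rw [b_re, cos_pi, Complex.ofReal_re]; ring
    · rw [b_im, sin_pi, Complex.ofReal_im]; ring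
  have c_pi : c π = ((2*β^4 + 16*β^3 + 40*β^2 + 32*β + 3) / 3 : ℝ) := by
    apply Complex.ext
    · rw [c_re, cos_pi, Complex.ofReal_re]; ring
    · rw [c_im, sin_pi, Complex.ofReal_im]; ring
  have bdd_c : 1 ≤ β → BddAbove ((fun θ : ℝ => ‖c θ / a θ‖) '' Ico (0 : ℝ) (2 * π)) := fun hβ =>
    (hbdd _ (c_cont.div a_cont (a_ne hβ)).norm).1
  refine ⟨fun hβ => ?_, ?_⟩
  · have hD : 0 < 10*β^4 + 60*β^3 + 90*β^2 - 32 := by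
      obtain ⟨t, ht, rfl⟩ : ∃ t : ℝ, 0 ≤ t ∧ β = 1 + t := ⟨β - 1, by linarith, by ring⟩
      ring_nf
      positivity
    have hB : 0 < 2*β^4 + 8*β^3 + 4*β^2 - 8*β - 3 := by
      obtain ⟨t, ht, rfl⟩ : ∃ t : ℝ, 0 ≤ t ∧ β = 1 + t := ⟨β - 1, by linarith, by ring⟩
      ring_nf
      positivity
    have hC : 0 < 2*β^4 + 16*β^3 + 40*β^2 + 32*β + 3 := by positivity
    have hsup : 5*(2*β^4 + 16*β^3 + 40*β^2 + 32*β + 3) / (10*β^4 + 60*β^3 + 90*β^2 - 32) ≤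
        sSup ((fun θ : ℝ => ‖c θ / a θ‖) '' Ico (0 : ℝ) (2 * π)) := by
      refine le_trans (le_of_eq ?_) (le_csSup (bdd_c hβ) (mem_image_of_mem _ hπ))
      simp only [a_pi, c_pi, ← Complex.ofReal_div, Complex.norm_real, Real.norm_eq_abs]
      rw [abs_of_pos (by positivity)]
      field_simp
      norm_num
    have hinf : sInf ((fun θ : ℝ => (b θ / a θ).re) '' Ico (0 : ℝ) (2 * π)) ≤
        5*(2*β^4 + 8*β^3 + 4*β^2 - 8*β - 3) / (10*β^4 + 60*β^3 + 90*β^2 - 32) := by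
      refine (csInf_le (hbdd _ (Complex.continuous_re.comp
        (b_cont.div a_cont (a_ne hβ)))).2 (mem_image_of_mem _ hπ)).trans (le_of_eq ?_)
      simp only [Function.comp_apply, Pi.div_apply, a_pi, b_pi, ← Complex.ofReal_div,
        Complex.ofReal_re]
      field_simp
      ring
    refine ⟨fun θ _ => a_ne hβ θ, ?_, hsup, hinf, ?_⟩
    · refine le_trans (le_of_eq ?_) (le_csSup
        (hbdd _ (continuous_const.div a_cont (a_ne hβ)).norm).1 (mem_image_of_mem _ h0))
      simp [a_zero]
    · rw [div_le_div_iff₀ (lt_of_lt_of_le (by positivity) hsup) hC]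
      calc _ ≤ 5*(2*β^4 + 8*β^3 + 4*β^2 - 8*β - 3) / (10*β^4 + 60*β^3 + 90*β^2 - 32)
            * (2*β^4 + 16*β^3 + 40*β^2 + 32*β + 3) := by gcongr
        _ = (2*β^4 + 8*β^3 + 4*β^2 - 8*β - 3) * (5*(2*β^4 + 16*β^3 + 40*β^2 + 32*β + 3)
            / (10*β^4 + 60*β^3 + 90*β^2 - 32)) := by ring
        _ ≤ _ := by gcongr
  · rintro rfl
    have hβ : (1 : ℝ) ≤ 20 := by norm_num
    have hne : ∀ f : ℝ → ℝ, (f '' Ico (0 : ℝ) (2 * π)).Nonempty := fun f => ⟨_, mem_image_of_mem f h0⟩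
    have a_pos : ∀ θ, 0 < ‖a θ‖ := fun θ => norm_pos_iff.2 (a_ne hβ θ)
    norm_num [cubicCoeff, quarticCoeff] at norm_a
    have norm_c : ∀ θ, ‖c θ‖ ^ 2 = 1 - 12467840 * (1 - cos θ) ^ 3
        + 1505491680 * (1 - cos θ) ^ 4 := by
      intro θ
      rw [← Complex.normSq_eq_norm_sq, Complex.normSq_apply, c_re, c_im, mul_mul_mul_comm (sin θ),
        ← sq (sin θ), sin_sq]
      ring
    have re_b : ∀ θ, (b θ).re * (a θ).re + (b θ).im * (a θ).im =
        1 - (1 - cos θ) / 6 - (1 - cos θ) ^ 2 / 30 - 151701277 / 15 * (1 - cos θ) ^ 3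
        + 3413388286 / 3 * (1 - cos θ) ^ 4 := by
      intro θ
      rw [b_re, b_im, a_re, a_im, mul_mul_mul_comm (sin θ), ← sq (sin θ), sin_sq]
      ring
    have hsup : sSup ((fun θ : ℝ => ‖c θ / a θ‖) '' Ico (0 : ℝ) (2 * π)) ≤ 2501825/2115968 := by
      refine csSup_le (hne _) (forall_mem_image.2 fun θ _ => ?_)
      rw [norm_div, div_le_iff₀ (a_pos θ)]
      refine (sq_le_sq₀ (by positivity) (by positivity)).1 ?_
      have h1 := hx θ
      have hq := quartic_pos (P := 2501825^2/2115968^2*(108383353/10) - 12467840)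
        (Q := 2501825^2/2115968^2*(31227983196/25) - 1505491680)
        (R := 2501825^2/2115968^2 - 1) (by norm_num) (by norm_num) (1 - cos θ)
      rw [mul_pow, norm_a, norm_c]
      nlinarith [sq_nonneg (1 - cos θ)]
    have hinf : 1769085/2115968 ≤
        sInf ((fun θ : ℝ => (b θ / a θ).re) '' Ico (0 : ℝ) (2 * π)) := by
      refine le_csInf (hne _) (forall_mem_image.2 fun θ _ => ?_)
      have h1 := hx θ
      have hq : 0 ≤ (1 - cos θ - 846/100000) ^ 2 *
          (741531983094211/7934880 * (1 - cos θ) ^ 2 + 529336 * (1 - cos θ) + 2267) := by positivity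
      rw [Complex.div_re, ← add_div, re_b, Complex.normSq_eq_norm_sq,
        le_div_iff₀ (pow_pos (a_pos θ) 2), norm_a]
      nlinarith [sq_nonneg (1 - cos θ), pow_nonneg h1 3]
    refine ⟨?_, hsup, hinf, ?_⟩
    · refine csSup_le (hne _) (forall_mem_image.2 fun θ _ => ?_)
      rw [norm_div, norm_one, div_le_iff₀ (a_pos θ), ← div_le_iff₀' (by norm_num)]
      refine (sq_le_sq₀ (by positivity) (by positivity)).1 ?_
      have h1 := hx θ
      have hq := quartic_pos (P := 108383353/10) (Q := 31227983196/25) (R := 1 - (200/399)^2)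
        (by norm_num) (by norm_num) (1 - cos θ)
      rw [norm_a]
      nlinarith [sq_nonneg (1 - cos θ)]
    · have hpos : 0 < sSup ((fun θ : ℝ => ‖c θ / a θ‖) '' Ico (0 : ℝ) (2 * π)) := by
        refine lt_of_lt_of_le one_pos
          (le_trans (le_of_eq ?_) (le_csSup (bdd_c hβ) (mem_image_of_mem _ h0)))
        simp [a_zero, c_zero]
      rw [le_div_iff₀ hpos]
      linarith
end

section
/- Fix a real parameter γ ≥ 1 and define for θ ∈ [0,2π) the trigonometric polynomials a(θ) = (γ² + γ − 1/6) + (5/6 − 2γ²)e^{iθ} + (γ² − γ + 1/3)e^{2iθ}, b(θ) = γ² + (2γ − 2γ²)e^{iθ} + (γ² − 2γ + 1)e^{2iθ} and c(θ) = (γ² + 2γ) + (−2γ² − 2γ + 1)e^{iθ} + γ² e^{2iθ} (the semi-generating functions of the SIEMS3 scheme). Then a(θ) ≠ 0 for all θ, and: max_{θ∈[0,2π)} |1/a(θ)| = 1, max_{θ∈[0,2π)} |c(θ)/a(θ)| = 3(4γ² + 4γ − 1)/(12γ² − 2), and min_{θ∈[0,2π)} Re(b(θ)/a(θ)) = 3(2γ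 − 1)²/(12γ² − 2). Consequently the implicit–explicit controllability intensity of the SIEMS3 scheme equals (2γ − 1)²/(4γ² + 4γ − 1). -/
open Real Set

/-- A real quadratic vanishing at `-1` is nonnegative on `[-1, 1]` as soon as its linear
cofactor is nonnegative at both endpoints. -/
lemma quadratic_nonneg_of_root_neg_one {e₀ e₁ e₂ x : ℝ} (h₁ : -1 ≤ x) (h₂ : x ≤ 1)
    (hroot : e₀ - e₁ + e₂ = 0) (hl : 0 ≤ e₀ - e₂) (hr : 0 ≤ e₀ + e₂) :
    0 ≤ e₀ + e₁ * x + e₂ * x ^ 2 := by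
  have h : e₀ + e₁ * x + e₂ * x ^ 2 =
      (1 + x) * ((1 + x) / 2 * (e₀ + e₂) + (1 - x) / 2 * (e₀ - e₂)) := by
    linear_combination (-x) * hroot
  rw [h]
  have := mul_nonneg (by linarith : 0 ≤ (1 + x) / 2) hr
  have := mul_nonneg (by linarith : 0 ≤ (1 - x) / 2) hl
  exact mul_nonneg (by linarith) (by linarith)

lemma mul_quadratic_le_mul_quadratic {k l e₀ e₁ e₂ f₀ f₁ f₂ x : ℝ} (h₁ : -1 ≤ x) (h₂ : x ≤ 1)
    (hroot : l * f₀ - k * e₀ - (l * f₁ - k * e₁) + (l * f₂ - k * e₂) = 0)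
    (hl : 0 ≤ l * f₀ - k * e₀ - (l * f₂ - k * e₂))
    (hr : 0 ≤ l * f₀ - k * e₀ + (l * f₂ - k * e₂)) :
    k * (e₀ + e₁ * x + e₂ * x ^ 2) ≤ l * (f₀ + f₁ * x + f₂ * x ^ 2) := by
  linarith [quadratic_nonneg_of_root_neg_one h₁ h₂ hroot hl hr]

lemma trig_quadratic_re (p q r θ : ℝ) :
    ((p : ℂ) + q * Complex.exp (Complex.I * θ) + r * Complex.exp (2 * Complex.I * θ)).re =
      p + q * cos θ + r * (2 * cos θ ^ 2 - 1) := by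
  have h₁ : Complex.I * θ = (θ : ℂ) * Complex.I := by ring
  have h₂ : 2 * Complex.I * θ = ((2 * θ : ℝ) : ℂ) * Complex.I := by push_cast; ring
  rw [h₁, h₂, ← cos_two_mul]
  simp only [Complex.add_re, Complex.re_ofReal_mul, Complex.ofReal_re,
    Complex.exp_ofReal_mul_I_re]

lemma trig_quadratic_im (p q r θ : ℝ) :
    ((p : ℂ) + q * Complex.exp (Complex.I * θ) + r * Complex.exp (2 * Complex.I * θ)).im =
      q * sin θ + r * (2 * sin θ * cos θ) := by
  have h₁ : Complex.I * θ = (θ : ℂ) * Complex.I := by ring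
  have h₂ : 2 * Complex.I * θ = ((2 * θ : ℝ) : ℂ) * Complex.I := by push_cast; ring
  rw [h₁, h₂, ← sin_two_mul]
  simp only [Complex.add_im, Complex.im_ofReal_mul, Complex.ofReal_im,
    Complex.exp_ofReal_mul_I_im, zero_add]

/-- The real inner product of two trigonometric quadratics as a polynomial in `cos θ`. -/
lemma trig_quadratic_inner (p q r p' q' r' θ : ℝ) :
    (p + q * cos θ + r * (2 * cos θ ^ 2 - 1)) * (p' + q' * cos θ + r' * (2 * cos θ ^ 2 - 1)) +
      (q * sin θ + r * (2 * sin θ * cos θ)) * (q' * sin θ + r' * (2 * sin θ * cos θ)) =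
      (p * p' + q * q' + r * r' - (p * r' + r * p')) +
        (p * q' + q * p' + q * r' + r * q') * cos θ + 2 * (p * r' + r * p') * cos θ ^ 2 := by
  linear_combination (q + 2 * r * cos θ) * (q' + 2 * r' * cos θ) * sin_sq_add_cos_sq θ

/-- factors and implicit–explicit controllability intensity of
the γ-parameterized SIEMS3 scheme, for γ ≥ 1. -/
theorem stmt17 (γ : ℝ) (hγ : 1 ≤ γ) (a b c : ℝ → ℂ)
    (ha : ∀ θ : ℝ, a θ = ((γ:ℂ)^2 + (γ:ℂ) - 1/6)
        + (5/6 - 2*(γ:ℂ)^2) * Complex.exp (Complex.I * θ)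
        + ((γ:ℂ)^2 - (γ:ℂ) + 1/3) * Complex.exp (2 * Complex.I * θ))
    (hb : ∀ θ : ℝ, b θ = (γ:ℂ)^2
        + (2*(γ:ℂ) - 2*(γ:ℂ)^2) * Complex.exp (Complex.I * θ)
        + ((γ:ℂ)^2 - 2*(γ:ℂ) + 1) * Complex.exp (2 * Complex.I * θ))
    (hc : ∀ θ : ℝ, c θ = ((γ:ℂ)^2 + 2*(γ:ℂ))
        + (-2*(γ:ℂ)^2 - 2*(γ:ℂ) + 1) * Complex.exp (Complex.I * θ)
        + (γ:ℂ)^2 * Complex.exp (2 * Complex.I * θ)) :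
    (∀ θ ∈ Set.Ico (0:ℝ) (2*π), a θ ≠ 0) ∧
    sSup ((fun θ : ℝ => ‖1 / a θ‖) '' Set.Ico (0:ℝ) (2*π)) = 1 ∧
    sSup ((fun θ : ℝ => ‖c θ / a θ‖) '' Set.Ico (0:ℝ) (2*π)) =
      3*(4*γ^2 + 4*γ - 1) / (12*γ^2 - 2) ∧
    sInf ((fun θ : ℝ => (b θ / a θ).re) '' Set.Ico (0:ℝ) (2*π)) =
      3*(2*γ - 1)^2 / (12*γ^2 - 2) ∧
    sInf ((fun θ : ℝ => (b θ / a θ).re) '' Set.Ico (0:ℝ) (2*π)) /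
        sSup ((fun θ : ℝ => ‖c θ / a θ‖) '' Set.Ico (0:ℝ) (2*π)) =
      (2*γ - 1)^2 / (4*γ^2 + 4*γ - 1) := by
  have ha' : ∀ θ : ℝ, a θ = ((γ ^ 2 + γ - 1 / 6 : ℝ) : ℂ)
      + ((5 / 6 - 2 * γ ^ 2 : ℝ) : ℂ) * Complex.exp (Complex.I * θ)
      + ((γ ^ 2 - γ + 1 / 3 : ℝ) : ℂ) * Complex.exp (2 * Complex.I * θ) := by
    intro θ; rw [ha]; push_cast; rfl
  have hb' : ∀ θ : ℝ, b θ = ((γ ^ 2 : ℝ) : ℂ)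
      + ((2 * γ - 2 * γ ^ 2 : ℝ) : ℂ) * Complex.exp (Complex.I * θ)
      + ((γ ^ 2 - 2 * γ + 1 : ℝ) : ℂ) * Complex.exp (2 * Complex.I * θ) := by
    intro θ; rw [hb]; push_cast; rfl
  have hc' : ∀ θ : ℝ, c θ = ((γ ^ 2 + 2 * γ : ℝ) : ℂ)
      + ((-2 * γ ^ 2 - 2 * γ + 1 : ℝ) : ℂ) * Complex.exp (Complex.I * θ)
      + ((γ ^ 2 : ℝ) : ℂ) * Complex.exp (2 * Complex.I * θ) := by
    intro θ; rw [hc]; push_cast; rfl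
  obtain ⟨d, hd, rfl⟩ : ∃ d : ℝ, 0 ≤ d ∧ γ = 1 + d := ⟨γ - 1, by linarith, by ring⟩
  have hA : 0 < 12 * (1 + d) ^ 2 - 2 := by nlinarith
  have hC : 0 < 4 * (1 + d) ^ 2 + 4 * (1 + d) - 1 := by nlinarith
  have exp_zero : Complex.exp (Complex.I * (0 : ℝ)) = 1 := by simp
  have exp_zero_two : Complex.exp (2 * Complex.I * (0 : ℝ)) = 1 := by simp
  have exp_pi : Complex.exp (Complex.I * π) = -1 := by
    rw [mul_comm, Complex.exp_pi_mul_I]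
  have exp_pi_two : Complex.exp (2 * Complex.I * π) = 1 := by
    rw [mul_right_comm, Complex.exp_two_pi_mul_I]
  have a_zero : a 0 = 1 := by
    rw [ha, exp_zero, exp_zero_two]; ring
  have a_pi : a π = (((12 * (1 + d) ^ 2 - 2) / 3 : ℝ) : ℂ) := by
    rw [ha, exp_pi, exp_pi_two]; push_cast; ring
  have b_pi : b π = (((2 * (1 + d) - 1) ^ 2 : ℝ) : ℂ) := by
    rw [hb, exp_pi, exp_pi_two]; push_cast; ring
  have c_pi : c π = ((4 * (1 + d) ^ 2 + 4 * (1 + d) - 1 : ℝ) : ℂ) := by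
    rw [hc, exp_pi, exp_pi_two]; push_cast; ring
  have one_le_normSq : ∀ θ : ℝ, 1 ≤ Complex.normSq (a θ) := by
    intro θ
    rw [Complex.normSq_apply, ha', trig_quadratic_re, trig_quadratic_im, trig_quadratic_inner]
    have h₁ := neg_one_le_cos θ
    have h₂ := cos_le_one θ
    have := quadratic_nonneg_of_root_neg_one (x := -cos θ)
      (e₀ := ((1 + d) ^ 2 + (1 + d) - 1 / 6) ^ 2 + (5 / 6 - 2 * (1 + d) ^ 2) ^ 2 +
        ((1 + d) ^ 2 - (1 + d) + 1 / 3) ^ 2 -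
        2 * (((1 + d) ^ 2 + (1 + d) - 1 / 6) * ((1 + d) ^ 2 - (1 + d) + 1 / 3)) - 1)
      (e₁ := -(2 * (5 / 6 - 2 * (1 + d) ^ 2) *
        ((1 + d) ^ 2 + (1 + d) - 1 / 6 + ((1 + d) ^ 2 - (1 + d) + 1 / 3))))
      (e₂ := 4 * (((1 + d) ^ 2 + (1 + d) - 1 / 6) * ((1 + d) ^ 2 - (1 + d) + 1 / 3)))
      (by linarith) (by linarith) (by ring) (by ring_nf; positivity) (by ring_nf; positivity)
    linarith
  have normSq_le : ∀ θ : ℝ, (12 * (1 + d) ^ 2 - 2) ^ 2 * Complex.normSq (c θ) ≤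
      (3 * (4 * (1 + d) ^ 2 + 4 * (1 + d) - 1)) ^ 2 * Complex.normSq (a θ) := by
    intro θ
    rw [Complex.normSq_apply, Complex.normSq_apply, ha', hc', trig_quadratic_re,
      trig_quadratic_im, trig_quadratic_re, trig_quadratic_im, trig_quadratic_inner,
      trig_quadratic_inner]
    exact mul_quadratic_le_mul_quadratic (neg_one_le_cos θ) (cos_le_one θ) (by ring)
      (by ring_nf; positivity) (by ring_nf; positivity)
  have inner_ge : ∀ θ : ℝ, 3 * (2 * (1 + d) - 1) ^ 2 * Complex.normSq (a θ) ≤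
      (12 * (1 + d) ^ 2 - 2) * ((b θ).re * (a θ).re + (b θ).im * (a θ).im) := by
    intro θ
    rw [Complex.normSq_apply, ha', hb', trig_quadratic_re,
      trig_quadratic_im, trig_quadratic_re, trig_quadratic_im, trig_quadratic_inner,
      trig_quadratic_inner]
    exact mul_quadratic_le_mul_quadratic (neg_one_le_cos θ) (cos_le_one θ) (by ring)
      (by ring_nf; positivity) (by ring_nf; positivity)
  have normSq_pos : ∀ θ : ℝ, 0 < Complex.normSq (a θ) := fun θ =>
    one_pos.trans_le (one_le_normSq θ)
  have norm_pos : ∀ θ : ℝ, 0 < ‖a θ‖ := fun θ =>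
    norm_pos_iff.2 (Complex.normSq_pos.1 (normSq_pos θ))
  have zero_mem : (0 : ℝ) ∈ Set.Ico (0 : ℝ) (2 * π) := ⟨le_rfl, by positivity⟩
  have pi_mem : π ∈ Set.Ico (0 : ℝ) (2 * π) := ⟨pi_pos.le, by linarith [pi_pos]⟩
  have sup_one : sSup ((fun θ : ℝ => ‖1 / a θ‖) '' Set.Ico (0 : ℝ) (2 * π)) = 1 := by
    refine IsGreatest.csSup_eq ⟨⟨0, zero_mem, by simp [a_zero]⟩, ?_⟩
    rintro _ ⟨θ, -, rfl⟩
    have h := one_le_normSq θ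
    rw [Complex.normSq_eq_norm_sq] at h
    simp only [norm_div, norm_one]
    rw [div_le_one (norm_pos θ)]
    nlinarith [norm_pos θ]
  have sup_c : sSup ((fun θ : ℝ => ‖c θ / a θ‖) '' Set.Ico (0 : ℝ) (2 * π)) =
      3 * (4 * (1 + d) ^ 2 + 4 * (1 + d) - 1) / (12 * (1 + d) ^ 2 - 2) := by
    refine IsGreatest.csSup_eq ⟨⟨π, pi_mem, ?_⟩, ?_⟩
    · simp only [a_pi, c_pi]
      rw [← Complex.ofReal_div, Complex.norm_of_nonneg (by positivity)]
      field_simp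
    · rintro _ ⟨θ, -, rfl⟩
      have h := normSq_le θ
      simp only [Complex.normSq_eq_norm_sq, ← mul_pow] at h
      have h' := le_of_sq_le_sq h (by positivity)
      simp only [norm_div]
      rw [div_le_div_iff₀ (norm_pos θ) hA]
      linarith
  have inf_b : sInf ((fun θ : ℝ => (b θ / a θ).re) '' Set.Ico (0 : ℝ) (2 * π)) =
      3 * (2 * (1 + d) - 1) ^ 2 / (12 * (1 + d) ^ 2 - 2) := by
    refine IsLeast.csInf_eq ⟨⟨π, pi_mem, ?_⟩, ?_⟩
    · simp only [a_pi, b_pi]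
      rw [← Complex.ofReal_div, Complex.ofReal_re]
      field_simp
    · rintro _ ⟨θ, -, rfl⟩
      simp only [Complex.div_re]
      rw [← add_div, div_le_div_iff₀ hA (normSq_pos θ)]
      linarith [inner_ge θ]
  refine ⟨fun θ _ => Complex.normSq_pos.1 (normSq_pos θ), sup_one, sup_c, inf_b, ?_⟩
  rw [sup_c, inf_b, div_div_div_cancel_right₀ hA.ne', mul_div_mul_left _ _ three_ne_zero]
end

section
/- Fix a real parameter γ ≥ 6/5 and define for θ ∈ [0,2π) the trigonometric polynomials a(θ) = (γ³ + 3γ²/2 − γ/2 + 1/12) + (−3γ³ − 3γ²/2 + 3γ − 5/12)e^{iθ} + (3γ³ − 3γ²/2 − 3γ/2 + 13/12)e^{2iθ} + (−γ³ + 3γ²/2 − γ + 1/4)e^{3iθ}, b(θ) = γ³ + (3γ² − 3γ³)e^{iθ} + (3γ³ − 6γ² + 3γ)e^{2iθ} + (−γ³ + 3γ² − 3γ + 1)e^{3iθ} and c(θ) = (γ³ + 3γ²) + (−3γ³ − 6γ² + 3γ)e^{iθ} + (3γ³ + 3γ² − 3γ + 1)e^{2iθ} − γ³ e^{3iθ}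 (the semi-generating functions of the SIEMS4 scheme). Then a(θ) ≠ 0 for all θ, and: max_{θ∈[0,2π)} |1/a(θ)| = 1, max_{θ∈[0,2π)} |c(θ)/a(θ)| = 3(8γ³ + 12γ² − 6γ + 1)/(4(6γ³ − 3γ + 1)), and min_{θ∈[0,2π)} Re(b(θ)/a(θ)) = 3(2γ − 1)³/(4(6γ³ − 3γ + 1)). Consequently the implicit–explicit controllability intensity of the SIEMS4 scheme equals (2γ − 1)³/(8γ³ + 12γ² − 6γ + 1). -/
open Real Set

/-- The cubic trigonometric polynomial with real coefficients `p`, evaluated at a point `z`. -/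
noncomputable def cubicAt (p₀ p₁ p₂ p₃ : ℝ) (z : ℂ) : ℂ :=
  p₀ + p₁ * z + p₂ * z ^ 2 + p₃ * z ^ 3

/-- The cosine polynomial representing `Re (p * conj q)` on the unit circle, where `x = Re z`. -/
def cosinePairing (p₀ p₁ p₂ p₃ q₀ q₁ q₂ q₃ x : ℝ) : ℝ :=
  (p₀ * q₀ + p₁ * q₁ + p₂ * q₂ + p₃ * q₃)
    + (p₀ * q₁ + p₁ * q₀ + p₁ * q₂ + p₂ * q₁ + p₂ * q₃ + p₃ * q₂) * x
    + (p₀ * q₂ + p₂ * q₀ + p₁ * q₃ + p₃ * q₁) * (2 * x ^ 2 - 1)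
    + (p₀ * q₃ + p₃ * q₀) * (4 * x ^ 3 - 3 * x)

lemma cubicAt_re (p₀ p₁ p₂ p₃ : ℝ) {z : ℂ} (hz : z.re ^ 2 + z.im ^ 2 = 1) :
    (cubicAt p₀ p₁ p₂ p₃ z).re =
      p₀ + p₁ * z.re + p₂ * (2 * z.re ^ 2 - 1) + p₃ * (4 * z.re ^ 3 - 3 * z.re) := by
  simp only [cubicAt, pow_succ, pow_zero, one_mul, Complex.add_re, Complex.mul_re,
    Complex.mul_im, Complex.ofReal_re, Complex.ofReal_im]
  linear_combination (-p₂ - 3 * p₃ * z.re) * hz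

lemma cubicAt_im (p₀ p₁ p₂ p₃ : ℝ) {z : ℂ} (hz : z.re ^ 2 + z.im ^ 2 = 1) :
    (cubicAt p₀ p₁ p₂ p₃ z).im =
      z.im * (p₁ + 2 * p₂ * z.re + p₃ * (4 * z.re ^ 2 - 1)) := by
  simp only [cubicAt, pow_succ, pow_zero, one_mul, Complex.add_im, Complex.mul_re,
    Complex.mul_im, Complex.ofReal_re, Complex.ofReal_im]
  linear_combination (-p₃ * z.im) * hz

lemma re_mul_re_add_im_mul_im_cubicAt (p₀ p₁ p₂ p₃ q₀ q₁ q₂ q₃ : ℝ) {z : ℂ}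
    (hz : z.re ^ 2 + z.im ^ 2 = 1) :
    (cubicAt p₀ p₁ p₂ p₃ z).re * (cubicAt q₀ q₁ q₂ q₃ z).re
      + (cubicAt p₀ p₁ p₂ p₃ z).im * (cubicAt q₀ q₁ q₂ q₃ z).im =
      cosinePairing p₀ p₁ p₂ p₃ q₀ q₁ q₂ q₃ z.re := by
  rw [cubicAt_re _ _ _ _ hz, cubicAt_re _ _ _ _ hz, cubicAt_im _ _ _ _ hz,
    cubicAt_im _ _ _ _ hz, cosinePairing]
  linear_combination (p₁ + 2 * p₂ * z.re + p₃ * (4 * z.re ^ 2 - 1)) *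
    (q₁ + 2 * q₂ * z.re + q₃ * (4 * z.re ^ 2 - 1)) * hz

lemma normSq_cubicAt (p₀ p₁ p₂ p₃ : ℝ) {z : ℂ} (hz : z.re ^ 2 + z.im ^ 2 = 1) :
    Complex.normSq (cubicAt p₀ p₁ p₂ p₃ z) =
      cosinePairing p₀ p₁ p₂ p₃ p₀ p₁ p₂ p₃ z.re := by
  rw [Complex.normSq_apply, re_mul_re_add_im_mul_im_cubicAt _ _ _ _ _ _ _ _ hz]

namespace SIEMS4

/-- The generating polynomial of the time-derivative part. -/
noncomputable def timePart (γ : ℝ) : ℂ → ℂ :=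
  cubicAt (γ^3 + 3*γ^2/2 - γ/2 + 1/12) (-3*γ^3 - 3*γ^2/2 + 3*γ - 5/12)
    (3*γ^3 - 3*γ^2/2 - 3*γ/2 + 13/12) (-γ^3 + 3*γ^2/2 - γ + 1/4)

/-- The generating polynomial of the implicit part. -/
noncomputable def implicitPart (γ : ℝ) : ℂ → ℂ :=
  cubicAt (γ^3) (3*γ^2 - 3*γ^3) (3*γ^3 - 6*γ^2 + 3*γ) (-γ^3 + 3*γ^2 - 3*γ + 1)

/-- The generating polynomial of the explicit part. -/
noncomputable def explicitPart (γ : ℝ) : ℂ → ℂ :=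
  cubicAt (γ^3 + 3*γ^2) (-3*γ^3 - 6*γ^2 + 3*γ) (3*γ^3 + 3*γ^2 - 3*γ + 1) (-γ^3)

lemma one_le_normSq_timePart {γ : ℝ} (hγ : 6/5 ≤ γ) {z : ℂ}
    (hz : z.re ^ 2 + z.im ^ 2 = 1) : 1 ≤ Complex.normSq (timePart γ z) := by
  rw [timePart, normSq_cubicAt _ _ _ _ hz]
  obtain ⟨u, hu⟩ : ∃ u, u = 1 - z.re := ⟨_, rfl⟩
  have hu0 : 0 ≤ u := by nlinarith [sq_nonneg z.im]
  have hu2 : u ≤ 2 := by nlinarith [sq_nonneg z.im]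
  have hx : z.re = 1 - u := by linarith
  rw [hx]
  obtain ⟨d, rfl⟩ : ∃ d, γ = d + 6/5 := ⟨γ - 6/5, by ring⟩
  have hd : 0 ≤ d := by linarith
  have key : 0 ≤ (6*d^2 + 42/5*d + 241/150) + (12*d^4 + 148/5*d^3
      + 497/25*d^2 - 27/125*d - 12242/5625)*u + (8*d^6 + 288/5*d^5 + 794/5*d^4 + 16946/75*d^3
      + 22484/125*d^2 + 723169/9375*d + 1309763/93750)*u^2 := by
    have h₁ : 0 ≤ d * (2 - u) := mul_nonneg hd (by linarith)
    have h₂ : 0 ≤ 12*d^4 + 148/5*d^3 + 497/25*d^2 := by positivity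
    have h₃ : 0 ≤ 8*d^6 + 288/5*d^5 + 794/5*d^4 + 16946/75*d^3 + 22484/125*d^2
        + 723169/9375*d := by positivity
    nlinarith [sq_nonneg (u - 1), mul_nonneg h₂ hu0, mul_nonneg h₃ (sq_nonneg u), sq_nonneg d]
  unfold cosinePairing
  linear_combination u * key

lemma normSq_explicitPart_le {γ : ℝ} (hγ : 6/5 ≤ γ) {z : ℂ}
    (hz : z.re ^ 2 + z.im ^ 2 = 1) :
    (4*(6*γ^3 - 3*γ + 1))^2 * Complex.normSq (explicitPart γ z) ≤
      (3*(8*γ^3 + 12*γ^2 - 6*γ + 1))^2 * Complex.normSq (timePart γ z) := by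
  rw [timePart, explicitPart, normSq_cubicAt _ _ _ _ hz, normSq_cubicAt _ _ _ _ hz]
  obtain ⟨u, hu⟩ : ∃ u, u = 1 - z.re := ⟨_, rfl⟩
  have hu0 : 0 ≤ u := by nlinarith [sq_nonneg z.im]
  have hu2 : 0 ≤ 2 - u := by nlinarith [sq_nonneg z.im]
  have hx : z.re = 1 - u := by linarith
  rw [hx]
  obtain ⟨d, rfl⟩ : ∃ d, γ = d + 6/5 := ⟨γ - 6/5, by ring⟩
  have hd : 0 ≤ d := by linarith
  have key : 0 ≤ (2 - u) * ((864*d^5 + 5688*d^4 + 70944/5*d^3 + 426582/25*d^2 + 250194/25*d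
      + 14426293/6250) + (5184*d^7 + 207168/5*d^6 + 3376944/25*d^5 + 5863428/25*d^4
      + 29339208/125*d^3 + 421902939/3125*d^2 + 639792693/15625*d + 386177989/78125)*u
      + (11520*d^9 + 107712*d^8 + 2149632/5*d^7 + 24144224/25*d^6 + 33649728/25*d^5
      + 751716174/625*d^4 + 2135057742/3125*d^3 + 3652846002/15625*d^2 + 3288439779/78125*d
      + 427674219/156250)*u^2) := by
    positivity
  unfold cosinePairing
  linear_combination key

lemma le_re_implicitPart_mul_timePart {γ : ℝ} (hγ : 6/5 ≤ γ) {z : ℂ}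
    (hz : z.re ^ 2 + z.im ^ 2 = 1) :
    3*(2*γ - 1)^3 * Complex.normSq (timePart γ z) ≤
      4*(6*γ^3 - 3*γ + 1) * ((implicitPart γ z).re * (timePart γ z).re
        + (implicitPart γ z).im * (timePart γ z).im) := by
  rw [timePart, implicitPart, normSq_cubicAt _ _ _ _ hz,
    re_mul_re_add_im_mul_im_cubicAt _ _ _ _ _ _ _ _ hz]
  obtain ⟨u, hu⟩ : ∃ u, u = 1 - z.re := ⟨_, rfl⟩
  have hu0 : 0 ≤ u := by nlinarith [sq_nonneg z.im]
  have hu2 : 0 ≤ 2 - u := by nlinarith [sq_nonneg z.im]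
  have hx : z.re = 1 - u := by linarith
  rw [hx]
  obtain ⟨d, rfl⟩ : ∃ d, γ = d + 6/5 := ⟨γ - 6/5, by ring⟩
  have hd : 0 ≤ d := by linarith
  have key : 0 ≤ (2 - u) * ((18*d^2 + 141/5*d + 571/50) + (108*d^4 + 1582/5*d^3 + 8223/25*d^2
      + 17507/125*d + 35399/1875)*u + (240*d^6 + 996*d^5 + 1638*d^4 + 19966/15*d^3
      + 13336/25*d^2 + 52848/625*d + 7591/18750)*u^2) := by
    positivity
  unfold cosinePairing
  linear_combination key

lemma timePart_one (γ : ℝ) : timePart γ 1 = 1 := by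
  simp only [timePart, cubicAt]
  push_cast
  ring

lemma timePart_neg_one (γ : ℝ) :
    timePart γ (-1) = ((4*(6*γ^3 - 3*γ + 1) / 3 : ℝ) : ℂ) := by
  simp only [timePart, cubicAt]
  push_cast
  ring

lemma implicitPart_neg_one (γ : ℝ) : implicitPart γ (-1) = (((2*γ - 1)^3 : ℝ) : ℂ) := by
  simp only [implicitPart, cubicAt]
  push_cast
  ring

lemma explicitPart_neg_one (γ : ℝ) :
    explicitPart γ (-1) = ((8*γ^3 + 12*γ^2 - 6*γ + 1 : ℝ) : ℂ) := by
  simp only [explicitPart, cubicAt]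
  push_cast
  ring

end SIEMS4

open SIEMS4

/-- factors and implicit–explicit controllability intensity of
the γ-parameterized SIEMS4 scheme, for γ ≥ 6/5. -/
theorem stmt18 (γ : ℝ) (hγ : 6/5 ≤ γ) (a b c : ℝ → ℂ)
    (ha : ∀ θ : ℝ, a θ = ((γ:ℂ)^3 + 3*(γ:ℂ)^2/2 - (γ:ℂ)/2 + 1/12)
        + (-3*(γ:ℂ)^3 - 3*(γ:ℂ)^2/2 + 3*(γ:ℂ) - 5/12) * Complex.exp (Complex.I * θ)
        + (3*(γ:ℂ)^3 - 3*(γ:ℂ)^2/2 - 3*(γ:ℂ)/2 + 13/12) * Complex.exp (2 * Complex.I * θ)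
        + (-(γ:ℂ)^3 + 3*(γ:ℂ)^2/2 - (γ:ℂ) + 1/4) * Complex.exp (3 * Complex.I * θ))
    (hb : ∀ θ : ℝ, b θ = (γ:ℂ)^3
        + (3*(γ:ℂ)^2 - 3*(γ:ℂ)^3) * Complex.exp (Complex.I * θ)
        + (3*(γ:ℂ)^3 - 6*(γ:ℂ)^2 + 3*(γ:ℂ)) * Complex.exp (2 * Complex.I * θ)
        + (-(γ:ℂ)^3 + 3*(γ:ℂ)^2 - 3*(γ:ℂ) + 1) * Complex.exp (3 * Complex.I * θ))
    (hc : ∀ θ : ℝ, c θ = ((γ:ℂ)^3 + 3*(γ:ℂ)^2)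
        + (-3*(γ:ℂ)^3 - 6*(γ:ℂ)^2 + 3*(γ:ℂ)) * Complex.exp (Complex.I * θ)
        + (3*(γ:ℂ)^3 + 3*(γ:ℂ)^2 - 3*(γ:ℂ) + 1) * Complex.exp (2 * Complex.I * θ)
        - (γ:ℂ)^3 * Complex.exp (3 * Complex.I * θ)) :
    (∀ θ ∈ Set.Ico (0:ℝ) (2*π), a θ ≠ 0) ∧
    sSup ((fun θ : ℝ => ‖1 / a θ‖) '' Set.Ico (0:ℝ) (2*π)) = 1 ∧
    sSup ((fun θ : ℝ => ‖c θ / a θ‖) '' Set.Ico (0:ℝ) (2*π)) =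
      3*(8*γ^3 + 12*γ^2 - 6*γ + 1) / (4*(6*γ^3 - 3*γ + 1)) ∧
    sInf ((fun θ : ℝ => (b θ / a θ).re) '' Set.Ico (0:ℝ) (2*π)) =
      3*(2*γ - 1)^3 / (4*(6*γ^3 - 3*γ + 1)) ∧
    sInf ((fun θ : ℝ => (b θ / a θ).re) '' Set.Ico (0:ℝ) (2*π)) /
        sSup ((fun θ : ℝ => ‖c θ / a θ‖) '' Set.Ico (0:ℝ) (2*π)) =
      (2*γ - 1)^3 / (8*γ^3 + 12*γ^2 - 6*γ + 1) := by
  have hD : 0 < 4*(6*γ^3 - 3*γ + 1) := by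
    nlinarith [mul_nonneg (by linarith : (0:ℝ) ≤ γ - 6/5) (sq_nonneg γ)]
  have hN : 0 < 8*γ^3 + 12*γ^2 - 6*γ + 1 := by
    nlinarith [mul_nonneg (by linarith : (0:ℝ) ≤ γ - 6/5) (sq_nonneg γ)]
  have h_exp₂ : ∀ θ : ℝ,
      Complex.exp (2 * Complex.I * θ) = Complex.exp (Complex.I * θ) ^ 2 := fun θ => by
    rw [← Complex.exp_nat_mul]; push_cast; ring_nf
  have h_exp₃ : ∀ θ : ℝ,
      Complex.exp (3 * Complex.I * θ) = Complex.exp (Complex.I * θ) ^ 3 := fun θ => by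
    rw [← Complex.exp_nat_mul]; push_cast; ring_nf
  have ha' : ∀ θ, a θ = timePart γ (Complex.exp (Complex.I * θ)) := fun θ => by
    rw [ha, h_exp₂, h_exp₃]; simp only [timePart, cubicAt]; push_cast; ring
  have hb' : ∀ θ, b θ = implicitPart γ (Complex.exp (Complex.I * θ)) := fun θ => by
    rw [hb, h_exp₂, h_exp₃]; simp only [implicitPart, cubicAt]; push_cast; ring
  have hc' : ∀ θ, c θ = explicitPart γ (Complex.exp (Complex.I * θ)) := fun θ => by
    rw [hc, h_exp₂, h_exp₃]; simp only [explicitPart, cubicAt]; push_cast; ring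
  have hz : ∀ θ : ℝ, (Complex.exp (Complex.I * θ)).re ^ 2
      + (Complex.exp (Complex.I * θ)).im ^ 2 = 1 := fun θ => by
    rw [mul_comm, Complex.exp_ofReal_mul_I_re, Complex.exp_ofReal_mul_I_im, add_comm]
    exact Real.sin_sq_add_cos_sq θ
  have h_normSq : ∀ θ, 1 ≤ Complex.normSq (a θ) := fun θ => by
    rw [ha']; exact one_le_normSq_timePart hγ (hz θ)
  have h_norm : ∀ θ, 1 ≤ ‖a θ‖ := fun θ => by
    have h := h_normSq θ
    rw [Complex.normSq_eq_norm_sq] at h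
    nlinarith [norm_nonneg (a θ)]
  have h_zero : (0:ℝ) ∈ Set.Ico (0:ℝ) (2*π) := ⟨le_rfl, by positivity⟩
  have h_pi : π ∈ Set.Ico (0:ℝ) (2*π) := ⟨pi_pos.le, by linarith [pi_pos]⟩
  have h_exp_pi : Complex.exp (Complex.I * (π : ℝ)) = -1 := by
    rw [mul_comm, Complex.exp_pi_mul_I]
  have ha_pi : a π = ((4*(6*γ^3 - 3*γ + 1) / 3 : ℝ) : ℂ) := by
    rw [ha', h_exp_pi, timePart_neg_one]
  have hb_pi : b π = (((2*γ - 1)^3 : ℝ) : ℂ) := by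
    rw [hb', h_exp_pi, implicitPart_neg_one]
  have hc_pi : c π = ((8*γ^3 + 12*γ^2 - 6*γ + 1 : ℝ) : ℂ) := by
    rw [hc', h_exp_pi, explicitPart_neg_one]
  have h_one : IsGreatest ((fun θ : ℝ => ‖1 / a θ‖) '' Set.Ico (0:ℝ) (2*π)) 1 := by
    refine ⟨⟨0, h_zero, ?_⟩, ?_⟩
    · simp [ha', timePart_one]
    · rintro _ ⟨θ, -, rfl⟩
      simpa using inv_le_one_of_one_le₀ (h_norm θ)
  have h_explicit : IsGreatest ((fun θ : ℝ => ‖c θ / a θ‖) '' Set.Ico (0:ℝ) (2*π))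
      (3*(8*γ^3 + 12*γ^2 - 6*γ + 1) / (4*(6*γ^3 - 3*γ + 1))) := by
    refine ⟨⟨π, h_pi, ?_⟩, ?_⟩
    · dsimp only
      rw [ha_pi, hc_pi, ← Complex.ofReal_div, Complex.norm_real, Real.norm_eq_abs,
        abs_of_pos (by positivity)]
      field_simp
    · rintro _ ⟨θ, -, rfl⟩
      have h := normSq_explicitPart_le hγ (hz θ)
      rw [← ha', ← hc', Complex.normSq_eq_norm_sq, Complex.normSq_eq_norm_sq,
        ← mul_pow, ← mul_pow] at h
      have h' := le_of_sq_le_sq h (by positivity)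
      dsimp only
      rw [norm_div, div_le_div_iff₀ (by linarith [h_norm θ]) hD]
      linarith
  have h_implicit : IsLeast ((fun θ : ℝ => (b θ / a θ).re) '' Set.Ico (0:ℝ) (2*π))
      (3*(2*γ - 1)^3 / (4*(6*γ^3 - 3*γ + 1))) := by
    refine ⟨⟨π, h_pi, ?_⟩, ?_⟩
    · dsimp only
      rw [ha_pi, hb_pi, ← Complex.ofReal_div, Complex.ofReal_re]
      field_simp
    · rintro _ ⟨θ, -, rfl⟩
      have h := le_re_implicitPart_mul_timePart hγ (hz θ)
      rw [← ha', ← hb'] at h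
      dsimp only
      rw [Complex.div_re, ← add_div, div_le_div_iff₀ hD (by linarith [h_normSq θ])]
      linarith
  refine ⟨fun θ _ => norm_pos_iff.mp (by linarith [h_norm θ]), h_one.csSup_eq,
    h_explicit.csSup_eq, h_implicit.csInf_eq, ?_⟩
  rw [h_explicit.csSup_eq, h_implicit.csInf_eq]
  rw [div_div_div_cancel_right₀ hD.ne', mul_div_mul_left _ _ three_ne_zero]
end
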